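/- Let (Π_n)_{n≥1} be a sequence of partitions of [0,T] with mesh |Π_n| → 0 such that the lower value functions V^{Π_n} converge uniformly on compact subsets of [0,T] × ℝ^d to a function V. Then V is a viscosity supersolution of the Hamilton–Jacobi–Isaacs equation ∂_t W(t,x) + sup_{μ ∈ ΔU} inf_{ν ∈ ΔV} f̃(t,x,μ,ν)·∇W(t,x) = 0 with terminal condition W(T,·) = g. -/

import Mathlib

open MeasureTheory Set Filter Topology
open scoped unitInterval RealInnerProductSpace ENNReal NNReal

noncomputable section

namespace DGameFormal

/-! ### The canonical sample space `Ω = ([0,1]²)^ℕ` -/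

/-- The sample space `Ω = ([0,1]²)^ℕ`.  The `j`-th coordinate mapping `ζ_{j+1}` of the paper is
`ω ↦ ω j` (we use `0`-based indexing, so the paper's `ζ_j`, `j ≥ 1`, is `ω ↦ ω (j-1)`). -/
abbrev Omega : Type := ℕ → (I × I)

/-- `𝓕_j`: the σ-field generated by the first `j` coordinate mappings `ζ_1, …, ζ_j`. -/
def Fsig (j : ℕ) : MeasurableSpace Omega :=
  MeasurableSpace.comap (fun ω (i : Fin j) => ω (i : ℕ)) inferInstance

/-- `𝓖_{j+1}`: the σ-field generated by the first component of the coordinate `ζ_{j+1}`. -/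
def Gsig (j : ℕ) : MeasurableSpace Omega :=
  MeasurableSpace.comap (fun ω => (ω j).1) inferInstance

/-- `𝓗_{j+1}`: the σ-field generated by the second component of the coordinate `ζ_{j+1}`. -/
def Hsig (j : ℕ) : MeasurableSpace Omega :=
  MeasurableSpace.comap (fun ω => (ω j).2) inferInstance

/-- `P` is the countable product `λ₂^{⊗ℕ}` of the two-dimensional Lebesgue (Borel) measure on the
unit square: it has the prescribed finite-dimensional distributions. -/
def IsProductMeasure (P : Measure Omega) : Prop :=
  ∀ m : ℕ, P.map (fun ω (i : Fin m) => ω (i : ℕ))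
      = Measure.pi (fun _ : Fin m => (volume : Measure (I × I)))

/-! ### Partitions of `[0,T]` -/

/-- A partition `0 = t_0 < t_1 < ⋯ < t_n = T` of the interval `[0,T]`. -/
structure Partition (T : ℝ) where
  n : ℕ
  npos : 0 < n
  t : ℕ → ℝ
  map_zero : t 0 = 0
  map_last : t n = T
  mono : ∀ i < n, t i < t (i + 1)

/-- The mesh `|Π|`: the maximal distance between two neighbouring points of the partition. -/
def Partition.mesh {T : ℝ} (π : Partition T) : ℝ :=
  (Finset.range π.n).sup' (Finset.nonempty_range_iff.2 π.npos.ne') fun i => π.t (i + 1) - π.t i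

open scoped Classical in
/-- For `t ∈ [t_i, t_{i+1})` the index `i` (and `n - 1` for `t ≥ t_{n-1}`). -/
def Partition.idx {T : ℝ} (π : Partition T) (s : ℝ) : ℕ :=
  Nat.findGreatest (fun i => π.t i ≤ s) (π.n - 1)

/-! ### Admissible controls along a partition -/

variable (U V : Type) [MeasurableSpace U] [MeasurableSpace V]

/-- Admissible controls for Player 1 along the partition `π`: measurable processes `u` such that on
each interval `[t_{j-1}, t_j)` of the partition, `u` is a countable sum `Σ_k 1_{Γ_{j,k}} u^{j,k}`
where `(Γ_{j,k})_k ⊆ 𝓕_{j-1}` is a partition of `Ω` and each `u^{j,k}` is `𝓖_j`-measurable. -/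
def AdmControl1 {T : ℝ} (π : Partition T) : Set (ℝ → Omega → U) :=
  {u | Measurable (Function.uncurry u) ∧
    ∀ j < π.n, ∃ (Γ : ℕ → Set Omega) (w : ℕ → ℝ → Omega → U),
      (∀ k, MeasurableSet[Fsig j] (Γ k)) ∧
      Pairwise (Function.onFun Disjoint Γ) ∧
      (⋃ k, Γ k) = univ ∧
      (∀ k s, Measurable[Gsig j] (w k s)) ∧
      (∀ k, ∀ ω ∈ Γ k, ∀ s ∈ Ico (π.t j) (π.t (j + 1)), u s ω = w k s ω)}

/-- Admissible controls for Player 2 along the partition `π` (with `𝓗_j` in place of `𝓖_j`). -/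
def AdmControl2 {T : ℝ} (π : Partition T) : Set (ℝ → Omega → V) :=
  {v | Measurable (Function.uncurry v) ∧
    ∀ j < π.n, ∃ (Γ : ℕ → Set Omega) (w : ℕ → ℝ → Omega → V),
      (∀ k, MeasurableSet[Fsig j] (Γ k)) ∧
      Pairwise (Function.onFun Disjoint Γ) ∧
      (⋃ k, Γ k) = univ ∧
      (∀ k s, Measurable[Hsig j] (w k s)) ∧
      (∀ k, ∀ ω ∈ Γ k, ∀ s ∈ Ico (π.t j) (π.t (j + 1)), v s ω = w k s ω)}

/-! ### Nonanticipative strategies with delay (NAD strategies) -/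

/-- A stopping time `τ : Ω → {0, 1, …, n-1}` of the discrete filtration `(𝓕_j)_j`. -/
def IsStoppingIdx {T : ℝ} (π : Partition T) (τ : Omega → ℕ) : Prop :=
  (∀ ω, τ ω < π.n) ∧ ∀ j, MeasurableSet[Fsig j] {ω | τ ω = j}

variable {U V}

/-- `u = u'`, `ds⊗dP`-a.e. on the stochastic interval `[[t, b]] = {(s,ω) | t ≤ s ≤ b ω}`. -/
def aeStEq {α : Type*} (P : Measure Omega) (t : ℝ) (b : Omega → ℝ)
    (u u' : ℝ → Omega → α) : Prop :=
  ∀ᵐ p ∂((volume : Measure ℝ).prod P), t ≤ p.1 → p.1 ≤ b p.2 → u p.1 p.2 = u' p.1 p.2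

/-- `u = u'`, `ds⊗dP`-a.e. on `[a,b] × Ω`. -/
def aeEqIcc {α : Type*} (P : Measure Omega) (a b : ℝ) (u u' : ℝ → Omega → α) : Prop :=
  ∀ᵐ p ∂((volume : Measure ℝ).prod P), p.1 ∈ Icc a b → u p.1 p.2 = u' p.1 p.2

variable (U V)

/-- NAD strategies for Player 1 on `[t,T]` along `π`: maps from admissible controls of Player 2 to
admissible controls of Player 1 such that controls agreeing `ds⊗dP`-a.e. on `[[t, t_τ]]`, for a
stopping time `τ`, are mapped to controls agreeing `ds⊗dP`-a.e. on `[[t, t_{τ+1}]]`. -/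
def IsNAD1 {T : ℝ} (P : Measure Omega) (π : Partition T) (t : ℝ)
    (α : (ℝ → Omega → V) → (ℝ → Omega → U)) : Prop :=
  (∀ v ∈ AdmControl2 V π, α v ∈ AdmControl1 U π) ∧
  ∀ τ : Omega → ℕ, IsStoppingIdx π τ →
    ∀ v v', v ∈ AdmControl2 V π → v' ∈ AdmControl2 V π →
      aeStEq P t (fun ω => π.t (τ ω)) v v' →
      aeStEq P t (fun ω => π.t (τ ω + 1)) (α v) (α v')

/-- NAD strategies for Player 2 on `[t,T]` along `π`. -/
def IsNAD2 {T : ℝ} (P : Measure Omega) (π : Partition T) (t : ℝ)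
    (β : (ℝ → Omega → U) → (ℝ → Omega → V)) : Prop :=
  (∀ u ∈ AdmControl1 U π, β u ∈ AdmControl2 V π) ∧
  ∀ τ : Omega → ℕ, IsStoppingIdx π τ →
    ∀ u u', u ∈ AdmControl1 U π → u' ∈ AdmControl1 U π →
      aeStEq P t (fun ω => π.t (τ ω)) u u' →
      aeStEq P t (fun ω => π.t (τ ω + 1)) (β u) (β u')

/-! ### The controlled dynamics -/

variable {U V}
variable {d : ℕ}

/-- `X` is the (continuous) solution on `[t,T]` of `X_s = x + ∫_t^s f(r, X_r, u_r, v_r) dr`. -/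
def IsSol (f : ℝ → EuclideanSpace ℝ (Fin d) → U → V → EuclideanSpace ℝ (Fin d)) (T t : ℝ)
    (x : EuclideanSpace ℝ (Fin d)) (u : ℝ → U) (v : ℝ → V)
    (X : ℝ → EuclideanSpace ℝ (Fin d)) : Prop :=
  ContinuousOn X (Icc t T) ∧ ∀ s ∈ Icc t T, X s = x + ∫ r in t..s, f r (X r) (u r) (v r)

/-- The solution `X^{t,x,u,v}` (chosen via the axiom of choice; under the standing assumptions it
is the unique continuous solution). -/
def sol (f : ℝ → EuclideanSpace ℝ (Fin d) → U → V → EuclideanSpace ℝ (Fin d)) (T t : ℝ)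
    (x : EuclideanSpace ℝ (Fin d)) (u : ℝ → U) (v : ℝ → V) : ℝ → EuclideanSpace ℝ (Fin d) :=
  Classical.epsilon (IsSol f T t x u v)

/-- `(u,v)` is the couple of admissible controls associated with the couple of NAD strategies
`(α,β)` on `[t, tl]`:  `α(v) = u` and `β(u) = v`, `ds⊗dP`-a.e. on `[t,tl] × Ω`. -/
def IsFixPair {T : ℝ} (P : Measure Omega) (π : Partition T) (t tl : ℝ)
    (α : (ℝ → Omega → V) → (ℝ → Omega → U)) (β : (ℝ → Omega → U) → (ℝ → Omega → V))
    (u : ℝ → Omega → U) (v : ℝ → Omega → V) : Prop :=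
  u ∈ AdmControl1 U π ∧ v ∈ AdmControl2 V π ∧ aeEqIcc P t tl (α v) u ∧ aeEqIcc P t tl (β u) v

variable [Nonempty U] [Nonempty V]

/-- The couple of admissible controls associated with a couple of NAD strategies on `[t,tl]`
(chosen via the axiom of choice; by Lemma 2.1 it exists and is `ds⊗dP`-a.e. unique). -/
def fixPair {T : ℝ} (P : Measure Omega) (π : Partition T) (t tl : ℝ)
    (α : (ℝ → Omega → V) → (ℝ → Omega → U)) (β : (ℝ → Omega → U) → (ℝ → Omega → V)) :
    (ℝ → Omega → U) × (ℝ → Omega → V) :=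
  Classical.epsilon fun p => IsFixPair P π t tl α β p.1 p.2

/-- The state process `X^{t,x,α,β}` associated with a couple of NAD strategies on `[t,tl]`. -/
def solStrat (f : ℝ → EuclideanSpace ℝ (Fin d) → U → V → EuclideanSpace ℝ (Fin d)) {T : ℝ}
    (P : Measure Omega) (π : Partition T) (t tl : ℝ) (x : EuclideanSpace ℝ (Fin d))
    (α : (ℝ → Omega → V) → (ℝ → Omega → U)) (β : (ℝ → Omega → U) → (ℝ → Omega → V))
    (s : ℝ) (ω : Omega) : EuclideanSpace ℝ (Fin d) :=
  sol f T t x (fun r => (fixPair P π t tl α β).1 r ω) (fun r => (fixPair P π t tl α β).2 r ω) s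

/-- The terminal pay-off `g(X_T^{t,x,α,β})`. -/
def payoff (f : ℝ → EuclideanSpace ℝ (Fin d) → U → V → EuclideanSpace ℝ (Fin d))
    (g : EuclideanSpace ℝ (Fin d) → ℝ) {T : ℝ} (P : Measure Omega) (π : Partition T)
    (t : ℝ) (x : EuclideanSpace ℝ (Fin d))
    (α : (ℝ → Omega → V) → (ℝ → Omega → U)) (β : (ℝ → Omega → U) → (ℝ → Omega → V)) :
    Omega → ℝ :=
  fun ω => g (solStrat f P π t T x α β T ω)

/-! ### Essential suprema/infima of families of random variables -/

/-- `S` is the `P`-a.s. least upper bound of the family `(ξ_i)_{i}` of random variables. -/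
def IsEssSupFam {ι : Sort*} (P : Measure Omega) (ξ : ι → Omega → ℝ) (S : Omega → ℝ) : Prop :=
  (∀ i, ξ i ≤ᵐ[P] S) ∧ ∀ W : Omega → ℝ, (∀ i, ξ i ≤ᵐ[P] W) → S ≤ᵐ[P] W

/-- `S` is the `P`-a.s. greatest lower bound of the family `(ξ_i)_{i}` of random variables. -/
def IsEssInfFam {ι : Sort*} (P : Measure Omega) (ξ : ι → Omega → ℝ) (S : Omega → ℝ) : Prop :=
  (∀ i, S ≤ᵐ[P] ξ i) ∧ ∀ W : Omega → ℝ, (∀ i, W ≤ᵐ[P] ξ i) → W ≤ᵐ[P] S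

/-! ### Value functions along a partition -/

variable (U V)

/-- The defining property of the lower value function along `π`:
`S = esssup_{α} essinf_{β} E[g(X_T^{t,x,α,β}) | 𝓕_i]` for `t_i ≤ t < t_{i+1}`. -/
def IsLowerVal (f : ℝ → EuclideanSpace ℝ (Fin d) → U → V → EuclideanSpace ℝ (Fin d))
    (g : EuclideanSpace ℝ (Fin d) → ℝ) {T : ℝ} (P : Measure Omega) (π : Partition T)
    (t : ℝ) (x : EuclideanSpace ℝ (Fin d)) (S : Omega → ℝ) : Prop :=
  ∃ J : {α // IsNAD1 U V P π t α} → Omega → ℝ,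
    (∀ α, IsEssInfFam P
      (fun β : {β // IsNAD2 U V P π t β} => P[payoff f g P π t x α.1 β.1 | Fsig (π.idx t)])
      (J α)) ∧
    IsEssSupFam P J S

/-- The defining property of the upper value function along `π`. -/
def IsUpperVal (f : ℝ → EuclideanSpace ℝ (Fin d) → U → V → EuclideanSpace ℝ (Fin d))
    (g : EuclideanSpace ℝ (Fin d) → ℝ) {T : ℝ} (P : Measure Omega) (π : Partition T)
    (t : ℝ) (x : EuclideanSpace ℝ (Fin d)) (S : Omega → ℝ) : Prop :=
  ∃ J : {β // IsNAD2 U V P π t β} → Omega → ℝ,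
    (∀ β, IsEssSupFam P
      (fun α : {α // IsNAD1 U V P π t α} => P[payoff f g P π t x α.1 β.1 | Fsig (π.idx t)])
      (J β)) ∧
    IsEssInfFam P J S

/-- The lower value function along `π` seen as a random variable. -/
def lowerVal (f : ℝ → EuclideanSpace ℝ (Fin d) → U → V → EuclideanSpace ℝ (Fin d))
    (g : EuclideanSpace ℝ (Fin d) → ℝ) {T : ℝ} (P : Measure Omega) (π : Partition T)
    (t : ℝ) (x : EuclideanSpace ℝ (Fin d)) : Omega → ℝ :=
  Classical.epsilon (IsLowerVal U V f g P π t x)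

/-- The upper value function along `π` seen as a random variable. -/
def upperVal (f : ℝ → EuclideanSpace ℝ (Fin d) → U → V → EuclideanSpace ℝ (Fin d))
    (g : EuclideanSpace ℝ (Fin d) → ℝ) {T : ℝ} (P : Measure Omega) (π : Partition T)
    (t : ℝ) (x : EuclideanSpace ℝ (Fin d)) : Omega → ℝ :=
  Classical.epsilon (IsUpperVal U V f g P π t x)

/-- The (deterministic) lower value function along `π`: the expectation of `lowerVal`. -/
def lowerValD (f : ℝ → EuclideanSpace ℝ (Fin d) → U → V → EuclideanSpace ℝ (Fin d))
    (g : EuclideanSpace ℝ (Fin d) → ℝ) {T : ℝ} (P : Measure Omega) (π : Partition T)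
    (t : ℝ) (x : EuclideanSpace ℝ (Fin d)) : ℝ :=
  ∫ ω, lowerVal U V f g P π t x ω ∂P

/-- The (deterministic) upper value function along `π`: the expectation of `upperVal`. -/
def upperValD (f : ℝ → EuclideanSpace ℝ (Fin d) → U → V → EuclideanSpace ℝ (Fin d))
    (g : EuclideanSpace ℝ (Fin d) → ℝ) {T : ℝ} (P : Measure Omega) (π : Partition T)
    (t : ℝ) (x : EuclideanSpace ℝ (Fin d)) : ℝ :=
  ∫ ω, upperVal U V f g P π t x ω ∂P

/-! ### The Hamiltonian and viscosity solutions -/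

section Hamiltonian

variable (U V : Type) [MetricSpace U] [MetricSpace V] [MeasurableSpace U] [MeasurableSpace V]

/-- `f̃(t,x,μ,ν) = ∫_U ∫_V f(t,x,u,v) μ(du) ν(dv)` for mixed actions `μ ∈ Δ(U)`, `ν ∈ Δ(V)`. -/
def ftilde (f : ℝ → EuclideanSpace ℝ (Fin d) → U → V → EuclideanSpace ℝ (Fin d))
    (t : ℝ) (x : EuclideanSpace ℝ (Fin d)) (μ : ProbabilityMeasure U) (ν : ProbabilityMeasure V) :
    EuclideanSpace ℝ (Fin d) :=
  ∫ u, ∫ v, f t x u v ∂(ν : Measure V) ∂(μ : Measure U)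

/-- The Hamiltonian `sup_{μ ∈ ΔU} inf_{ν ∈ ΔV} f̃(t,x,μ,ν)·p`. -/
def ham (f : ℝ → EuclideanSpace ℝ (Fin d) → U → V → EuclideanSpace ℝ (Fin d))
    (t : ℝ) (x p : EuclideanSpace ℝ (Fin d)) : ℝ :=
  ⨆ μ : ProbabilityMeasure U, ⨅ ν : ProbabilityMeasure V, ⟪ftilde U V f t x μ ν, p⟫

/-- Viscosity subsolution of `∂_t W + sup_μ inf_ν f̃(t,x,μ,ν)·∇W = 0`, `W(T,·) = g`, on
`[0,T] × ℝ^d`. -/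
def IsViscSubsol (f : ℝ → EuclideanSpace ℝ (Fin d) → U → V → EuclideanSpace ℝ (Fin d))
    (g : EuclideanSpace ℝ (Fin d) → ℝ) (T : ℝ) (W : ℝ → EuclideanSpace ℝ (Fin d) → ℝ) : Prop :=
  (∀ x, W T x ≤ g x) ∧
  ∀ φ : ℝ → EuclideanSpace ℝ (Fin d) → ℝ,
    ContDiff ℝ 1 (fun q : ℝ × EuclideanSpace ℝ (Fin d) => φ q.1 q.2) →
    ∀ t x, t ∈ Ico (0 : ℝ) T →
      IsLocalMaxOn (fun q : ℝ × EuclideanSpace ℝ (Fin d) => W q.1 q.2 - φ q.1 q.2)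
        (Icc (0 : ℝ) T ×ˢ univ) (t, x) →
      0 ≤ deriv (fun s => φ s x) t + ham U V f t x (gradient (fun y => φ t y) x)

/-- Viscosity supersolution of `∂_t W + sup_μ inf_ν f̃(t,x,μ,ν)·∇W = 0`, `W(T,·) = g`, on
`[0,T] × ℝ^d`. -/
def IsViscSupersol (f : ℝ → EuclideanSpace ℝ (Fin d) → U → V → EuclideanSpace ℝ (Fin d))
    (g : EuclideanSpace ℝ (Fin d) → ℝ) (T : ℝ) (W : ℝ → EuclideanSpace ℝ (Fin d) → ℝ) : Prop :=
  (∀ x, g x ≤ W T x) ∧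
  ∀ φ : ℝ → EuclideanSpace ℝ (Fin d) → ℝ,
    ContDiff ℝ 1 (fun q : ℝ × EuclideanSpace ℝ (Fin d) => φ q.1 q.2) →
    ∀ t x, t ∈ Ico (0 : ℝ) T →
      IsLocalMinOn (fun q : ℝ × EuclideanSpace ℝ (Fin d) => W q.1 q.2 - φ q.1 q.2)
        (Icc (0 : ℝ) T ×ˢ univ) (t, x) →
      deriv (fun s => φ s x) t + ham U V f t x (gradient (fun y => φ t y) x) ≤ 0

end Hamiltonian

set_option linter.unusedSectionVars false

/-! ### Controlled differential equations -/

/-- An integral form of Gronwall's inequality. -/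
theorem le_exp_of_le_add_integral {D : ℝ → ℝ} {t b a K : ℝ} (hD : ContinuousOn D (Icc t b))
    (ha : 0 ≤ a) (hK : 0 < K)
    (h : ∀ s ∈ Icc t b, D s ≤ a + ∫ r in t..s, K * D r) :
    ∀ s ∈ Icc t b, D s ≤ 2 * a * Real.exp (2 * K * (s - t)) := by
  intro s hs
  have htb : t ≤ b := hs.1.trans hs.2
  obtain ⟨s₀, hs₀, hmax⟩ := isCompact_Icc.exists_isMaxOn (nonempty_Icc.2 htb)
    (f := fun s => Real.exp (-(2 * K * (s - t))) * D s)
    (ContinuousOn.mul (by fun_prop) hD)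
  set M := Real.exp (-(2 * K * (s₀ - t))) * D s₀ with hM
  have hle : ∀ r ∈ Icc t b, D r ≤ M * Real.exp (2 * K * (r - t)) := by
    intro r hr
    have := hmax hr
    simp only [mem_ofPred_eq] at this
    have h2 := mul_le_mul_of_nonneg_right this (Real.exp_pos (2 * K * (r - t))).le
    rw [mul_right_comm, ← Real.exp_add, neg_add_cancel, Real.exp_zero, one_mul] at h2
    exact h2
  have hint : ∫ r in t..s₀, K * D r ≤ M / 2 * (Real.exp (2 * K * (s₀ - t)) - 1) := by
    have hF : ∀ x ∈ uIcc t s₀, HasDerivAt (fun r => M / 2 * Real.exp (2 * K * (r - t)))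
        (K * (M * Real.exp (2 * K * (x - t)))) x := by
      intro x _
      have h1 : HasDerivAt (fun r => 2 * K * (r - t)) (2 * K) x := by
        simpa using ((hasDerivAt_id x).sub_const t).const_mul (2 * K)
      exact (h1.exp.const_mul (M / 2)).congr_deriv (by ring)
    have hcont : Continuous fun x => K * (M * Real.exp (2 * K * (x - t))) := by fun_prop
    have hI := intervalIntegral.integral_eq_sub_of_hasDerivAt hF (hcont.intervalIntegrable _ _)
    calc ∫ r in t..s₀, K * D r ≤ ∫ r in t..s₀, K * (M * Real.exp (2 * K * (r - t))) := by
          apply intervalIntegral.integral_mono_on hs₀.1 _ (hcont.intervalIntegrable _ _)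
          · intro r hr
            exact mul_le_mul_of_nonneg_left (hle r ⟨hr.1, hr.2.trans hs₀.2⟩) hK.le
          · apply ContinuousOn.intervalIntegrable
            rw [uIcc_of_le hs₀.1]
            exact continuousOn_const.mul (hD.mono (Icc_subset_Icc_right hs₀.2))
      _ = _ := by rw [hI]; simp; ring
  have h0 := h s₀ hs₀
  have hE : 1 ≤ Real.exp (2 * K * (s₀ - t)) :=
    Real.one_le_exp (by have := hs₀.1; apply mul_nonneg <;> linarith)
  have hD0 : D s₀ = M * Real.exp (2 * K * (s₀ - t)) := by
    rw [hM, mul_right_comm, ← Real.exp_add, neg_add_cancel, Real.exp_zero, one_mul]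
  have hM2 : M ≤ 2 * a := by
    by_contra! hlt
    rw [hD0] at h0
    nlinarith
  exact (hle s hs).trans (mul_le_mul_of_nonneg_right hM2 (Real.exp_pos _).le)

/-- Standing assumptions on the dynamics, with explicit bounds. -/
structure IsRegular {d : ℕ} {U V : Type} [TopologicalSpace U] [TopologicalSpace V] (T : ℝ)
    (f : ℝ → EuclideanSpace ℝ (Fin d) → U → V → EuclideanSpace ℝ (Fin d))
    (C K : ℝ) : Prop where
  bdd : ∀ t x u v, ‖f t x u v‖ ≤ C
  cont : ContinuousOn
    (fun q : ℝ × EuclideanSpace ℝ (Fin d) × U × V => f q.1 q.2.1 q.2.2.1 q.2.2.2)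
    (Icc (0 : ℝ) T ×ˢ univ)
  pos : 0 < K
  lip : ∀ t u v x y, ‖f t x u v - f t y u v‖ ≤ K * ‖x - y‖

section Ode

variable {d : ℕ} {U V : Type} [MetricSpace U] [CompactSpace U] [MetricSpace V] [CompactSpace V]
  [MeasurableSpace U] [BorelSpace U] [MeasurableSpace V] [BorelSpace V]
  {T : ℝ} {f : ℝ → EuclideanSpace ℝ (Fin d) → U → V → EuclideanSpace ℝ (Fin d)} {C K : ℝ}

theorem IsRegular.nonneg [Nonempty U] [Nonempty V] (hf : IsRegular T f C K) : 0 ≤ C :=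
  (norm_nonneg _).trans (hf.bdd 0 0 (Classical.arbitrary U) (Classical.arbitrary V))

/-- The dynamics, extended from `[0,T]` to all times by freezing them outside. -/
def frozen (T : ℝ) (hT : 0 ≤ T)
    (f : ℝ → EuclideanSpace ℝ (Fin d) → U → V → EuclideanSpace ℝ (Fin d)) :
    ℝ → EuclideanSpace ℝ (Fin d) → U → V → EuclideanSpace ℝ (Fin d) :=
  fun r => f (projIcc 0 T hT r)

theorem frozen_of_mem (hT : 0 ≤ T) {r : ℝ} (hr : r ∈ Icc 0 T) : frozen T hT f r = f r := by
  simp [frozen, projIcc_of_mem hT hr]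

theorem IsRegular.continuous_frozen (hf : IsRegular T f C K) (hT : 0 ≤ T) :
    Continuous (fun q : ℝ × EuclideanSpace ℝ (Fin d) × U × V =>
      frozen T hT f q.1 q.2.1 q.2.2.1 q.2.2.2) := by
  have h : Continuous (fun q : ℝ × EuclideanSpace ℝ (Fin d) × U × V =>
      (((projIcc 0 T hT q.1 : Icc (0 : ℝ) T) : ℝ), q.2)) := by fun_prop
  exact hf.cont.comp_continuous h fun q => ⟨(projIcc 0 T hT q.1).2, mem_univ _⟩

theorem IsRegular.measurable_frozen_comp (hf : IsRegular T f C K) (hT : 0 ≤ T) {Ω : Type*}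
    [MeasurableSpace Ω] {s : Ω → ℝ} {X : Ω → EuclideanSpace ℝ (Fin d)} {u : Ω → U} {v : Ω → V}
    (hs : Measurable s) (hX : Measurable X) (hu : Measurable u) (hv : Measurable v) :
    Measurable fun ω => frozen T hT f (s ω) (X ω) (u ω) (v ω) :=
  (hf.continuous_frozen hT).measurable.comp (hs.prodMk (hX.prodMk (hu.prodMk hv)))

theorem IsRegular.intervalIntegrable_frozen (hf : IsRegular T f C K) (hT : 0 ≤ T)
    {X : ℝ → EuclideanSpace ℝ (Fin d)} {u : ℝ → U} {v : ℝ → V}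
    {a b : ℝ} (hX : ContinuousOn X (uIcc a b)) (hu : Measurable u) (hv : Measurable v) :
    IntervalIntegrable (fun r => frozen T hT f r (X r) (u r) (v r)) volume a b := by
  have hX' : AEMeasurable X (volume.restrict (uIoc a b)) :=
    (hX.mono uIoc_subset_uIcc).aemeasurable measurableSet_uIoc
  rw [intervalIntegrable_iff]
  have : IsFiniteMeasure (volume.restrict (uIoc a b)) := by
    rw [uIoc]; infer_instance
  refine Integrable.of_bound (C := C) ?_ (ae_of_all _ fun r => hf.bdd _ _ _ _)
  exact ((hf.continuous_frozen hT).measurable.comp_aemeasurable (aemeasurable_id.prodMk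
    (hX'.prodMk (hu.aemeasurable.prodMk hv.aemeasurable)))).aestronglyMeasurable

theorem isSol_frozen_iff (hT : 0 ≤ T) {t : ℝ} (ht : 0 ≤ t) {x : EuclideanSpace ℝ (Fin d)}
    {u : ℝ → U} {v : ℝ → V} {X : ℝ → EuclideanSpace ℝ (Fin d)} :
    IsSol (frozen T hT f) T t x u v X ↔ IsSol f T t x u v X := by
  have key : ∀ s ∈ Icc t T, ∫ r in t..s, frozen T hT f r (X r) (u r) (v r)
      = ∫ r in t..s, f r (X r) (u r) (v r) := by
    intro s hs
    apply intervalIntegral.integral_congr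
    intro r hr
    rw [uIcc_of_le hs.1] at hr
    simp only [frozen_of_mem hT (f := f) ⟨ht.trans hr.1, hr.2.trans hs.2⟩]
  unfold IsSol
  refine and_congr_right fun _ => forall₂_congr fun s hs => ?_
  rw [key s hs]

/-- Stability of solutions with respect to the initial condition, on an interval on which the
controls agree. -/
theorem IsSol.norm_sub_le (hf : IsRegular T f C K) {t b : ℝ} (ht : 0 ≤ t) (hb : b ≤ T)
    {x x' : EuclideanSpace ℝ (Fin d)} {u u' : ℝ → U} {v v' : ℝ → V}
    {X X' : ℝ → EuclideanSpace ℝ (Fin d)} (hX : IsSol f T t x u v X)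
    (hX' : IsSol f T t x' u' v' X') (hu : Measurable u) (hv : Measurable v)
    (hu' : Measurable u') (hv' : Measurable v')
    (huu : ∀ᵐ r, r ∈ Icc t b → u r = u' r) (hvv : ∀ᵐ r, r ∈ Icc t b → v r = v' r) :
    ∀ s ∈ Icc t b, ‖X s - X' s‖ ≤ 2 * ‖x - x'‖ * Real.exp (2 * K * T) := by
  intro s hs
  have hT : 0 ≤ T := ht.trans (hs.1.trans (hs.2.trans hb))
  rw [← isSol_frozen_iff hT ht] at hX hX'
  have hsub : Icc t b ⊆ Icc t T := Icc_subset_Icc_right hb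
  have hcont : ContinuousOn (fun r => ‖X r - X' r‖) (Icc t b) :=
    ((hX.1.mono hsub).sub (hX'.1.mono hsub)).norm
  have := le_exp_of_le_add_integral hcont (norm_nonneg (x - x')) hf.pos ?_ s hs
  · refine this.trans ?_
    gcongr
    · linarith [hf.pos]
    · linarith [hs.2]
  intro s hs
  have hc : ContinuousOn (fun r => ‖X r - X' r‖) (uIcc t s) := by
    rw [uIcc_of_le hs.1]; exact hcont.mono (Icc_subset_Icc_right hs.2)
  have i1 : IntervalIntegrable (fun r => frozen T hT f r (X r) (u r) (v r)) volume t s :=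
    hf.intervalIntegrable_frozen hT (hX.1.mono (by
      rw [uIcc_of_le hs.1]; exact Icc_subset_Icc_right (hs.2.trans hb))) hu hv
  have i2 : IntervalIntegrable (fun r => frozen T hT f r (X' r) (u' r) (v' r)) volume t s :=
    hf.intervalIntegrable_frozen hT (hX'.1.mono (by
      rw [uIcc_of_le hs.1]; exact Icc_subset_Icc_right (hs.2.trans hb))) hu' hv'
  rw [hX.2 s (hsub hs), hX'.2 s (hsub hs), add_sub_add_comm, ← intervalIntegral.integral_sub i1 i2]
  refine (norm_add_le _ _).trans (add_le_add_right ?_ _)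
  refine intervalIntegral.norm_integral_le_of_norm_le hs.1 ?_
    (hc.intervalIntegrable.const_mul K)
  filter_upwards [huu, hvv] with r h1 h2 hr
  have hr' : r ∈ Icc t b := ⟨hr.1.le, hr.2.trans hs.2⟩
  rw [h1 hr', h2 hr']
  exact hf.lip _ _ _ _ _

theorem IsSol.congr_controls (hf : IsRegular T f C K) {t b : ℝ} (ht : 0 ≤ t) (hb : b ≤ T)
    {x : EuclideanSpace ℝ (Fin d)} {u u' : ℝ → U} {v v' : ℝ → V}
    {X X' : ℝ → EuclideanSpace ℝ (Fin d)} (hX : IsSol f T t x u v X)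
    (hX' : IsSol f T t x u' v' X') (hu : Measurable u) (hv : Measurable v)
    (hu' : Measurable u') (hv' : Measurable v')
    (huu : ∀ᵐ r, r ∈ Icc t b → u r = u' r) (hvv : ∀ᵐ r, r ∈ Icc t b → v r = v' r) :
    ∀ s ∈ Icc t b, X s = X' s := by
  intro s hs
  have := hX.norm_sub_le hf ht hb hX' hu hv hu' hv' huu hvv s hs
  rw [sub_self, norm_zero, mul_zero, zero_mul] at this
  exact sub_eq_zero.1 (norm_le_zero_iff.1 this)

theorem IsSol.norm_sub_initial_le (hf : IsRegular T f C K) {t s : ℝ}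
    (hs : s ∈ Icc t T)
    {x : EuclideanSpace ℝ (Fin d)} {u : ℝ → U} {v : ℝ → V}
    {X : ℝ → EuclideanSpace ℝ (Fin d)} (hX : IsSol f T t x u v X) :
    ‖X s - x‖ ≤ C * (s - t) := by
  rw [hX.2 s hs, add_sub_cancel_left]
  have := intervalIntegral.norm_integral_le_of_norm_le_const (a := t) (b := s) (C := C)
    (f := fun r => f r (X r) (u r) (v r)) fun r _ => hf.bdd _ _ _ _
  rwa [abs_of_nonneg (by linarith [hs.1])] at this

/-- The flow property: a solution restarted at a later time is a solution. -/
theorem IsSol.restart (hf : IsRegular T f C K) {t t' : ℝ} (ht : 0 ≤ t) (ht' : t' ∈ Icc t T)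
    {x : EuclideanSpace ℝ (Fin d)} {u : ℝ → U} {v : ℝ → V}
    {X : ℝ → EuclideanSpace ℝ (Fin d)} (hX : IsSol f T t x u v X)
    (hu : Measurable u) (hv : Measurable v) : IsSol f T t' (X t') u v X := by
  have hT : 0 ≤ T := ht.trans (ht'.1.trans ht'.2)
  rw [← isSol_frozen_iff hT ht] at hX
  rw [← isSol_frozen_iff hT (ht.trans ht'.1)]
  refine ⟨hX.1.mono (Icc_subset_Icc_left ht'.1), fun s hs => ?_⟩
  have hi : ∀ a b, a ∈ Icc t T → b ∈ Icc t T →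
      IntervalIntegrable (fun r => frozen T hT f r (X r) (u r) (v r)) volume a b :=
    fun a b ha hb => hf.intervalIntegrable_frozen hT (hX.1.mono (uIcc_subset_Icc ha hb)) hu hv
  have htT : t ∈ Icc t T := ⟨le_rfl, ht'.1.trans ht'.2⟩
  have hsT : s ∈ Icc t T := ⟨ht'.1.trans hs.1, hs.2⟩
  rw [hX.2 s hsT, hX.2 t' ht', add_assoc,
    intervalIntegral.integral_add_adjacent_intervals (hi _ _ htT ht') (hi _ _ ht' hsT)]

end Ode

section Picard

variable {d : ℕ} {U V : Type} [MetricSpace U] [CompactSpace U] [MetricSpace V] [CompactSpace V]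
  [MeasurableSpace U] [BorelSpace U] [MeasurableSpace V] [BorelSpace V]
  {T : ℝ} {f : ℝ → EuclideanSpace ℝ (Fin d) → U → V → EuclideanSpace ℝ (Fin d)} {C K : ℝ}

/-- The Picard iterates of a controlled differential equation. -/
def picard (F : ℝ → EuclideanSpace ℝ (Fin d) → U → V → EuclideanSpace ℝ (Fin d)) (t : ℝ)
    (x : EuclideanSpace ℝ (Fin d)) (u : ℝ → U) (v : ℝ → V) : ℕ → ℝ → EuclideanSpace ℝ (Fin d)
  | 0 => fun _ => x
  | m + 1 => fun s => x + ∫ r in Ioc t s, F r (picard F t x u v m r) (u r) (v r)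

theorem measurable_picard (hf : IsRegular T f C K) (hT : 0 ≤ T) {Ω : Type*} [MeasurableSpace Ω]
    {u : ℝ → Ω → U} {v : ℝ → Ω → V} (hu : Measurable (Function.uncurry u))
    (hv : Measurable (Function.uncurry v)) (t : ℝ) (x : EuclideanSpace ℝ (Fin d)) (m : ℕ) :
    Measurable fun p : ℝ × Ω =>
      picard (frozen T hT f) t x (fun r => u r p.2) (fun r => v r p.2) m p.1 := by
  induction m with
  | zero => exact measurable_const
  | succ m ih =>
    refine measurable_const.add ?_
    have hm : Measurable fun q : (ℝ × Ω) × ℝ => (Ioc t q.1.1).indicator (fun r =>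
        frozen T hT f r (picard (frozen T hT f) t x (fun r => u r q.1.2) (fun r => v r q.1.2) m r)
          (u r q.1.2) (v r q.1.2)) q.2 := by
      have h1 : Measurable fun q : (ℝ × Ω) × ℝ => frozen T hT f q.2
          (picard (frozen T hT f) t x (fun r => u r q.1.2) (fun r => v r q.1.2) m q.2)
          (u q.2 q.1.2) (v q.2 q.1.2) := by
        have hp : Measurable fun q : (ℝ × Ω) × ℝ => (q.2, q.1.2) := by fun_prop
        exact hf.measurable_frozen_comp hT measurable_snd (ih.comp hp) (hu.comp hp) (hv.comp hp)
      have hset : MeasurableSet {q : (ℝ × Ω) × ℝ | q.2 ∈ Ioc t q.1.1} :=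
        (measurableSet_lt measurable_const measurable_snd).inter
          (measurableSet_le measurable_snd (by fun_prop))
      exact h1.indicator hset
    have := (hm.stronglyMeasurable.integral_prod_right' (ν := volume)).measurable
    convert this using 2 with p
    exact (integral_indicator measurableSet_Ioc).symm

theorem continuousOn_picard (hf : IsRegular T f C K) (hT : 0 ≤ T)
    {u : ℝ → U} {v : ℝ → V} (hu : Measurable u) (hv : Measurable v) (t : ℝ)
    (x : EuclideanSpace ℝ (Fin d)) (m : ℕ) :
    ContinuousOn (picard (frozen T hT f) t x u v m) (Ici t) := by
  induction m with
  | zero => exact continuousOn_const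
  | succ m ih =>
    intro s hs
    have h : ContinuousOn (fun s => x + ∫ r in t..s, frozen T hT f r
        (picard (frozen T hT f) t x u v m r) (u r) (v r)) (Icc t (s + 1)) := by
      refine continuousOn_const.add ?_
      rw [← uIcc_of_le (by linarith [mem_Ici.1 hs] : t ≤ s + 1)]
      apply intervalIntegral.continuousOn_primitive_interval
      have := hf.intervalIntegrable_frozen hT (X := picard (frozen T hT f) t x u v m)
        (a := t) (b := s + 1) (ih.mono (by
          rw [uIcc_of_le (by linarith [mem_Ici.1 hs] : t ≤ s + 1)]; exact Icc_subset_Ici_self))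
        hu hv
      rwa [intervalIntegrable_iff'] at this
    have hev : Icc t (s + 1) ∈ 𝓝[Ici t] s := by
      rw [← Ici_inter_Iic]
      exact inter_mem self_mem_nhdsWithin (mem_nhdsWithin_of_mem_nhds (Iic_mem_nhds (by linarith)))
    have h2 := (h s ⟨hs, by linarith⟩).mono_of_mem_nhdsWithin hev
    refine h2.congr (fun y hy => ?_) ?_
    · simp only [picard]; rw [intervalIntegral.integral_of_le hy]
    · simp only [picard]; rw [intervalIntegral.integral_of_le hs]

theorem picard_succ_eq {F : ℝ → EuclideanSpace ℝ (Fin d) → U → V → EuclideanSpace ℝ (Fin d)}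
    {t s : ℝ} (hs : t ≤ s) {x : EuclideanSpace ℝ (Fin d)} {u : ℝ → U} {v : ℝ → V} (m : ℕ) :
    picard F t x u v (m + 1) s = x + ∫ r in t..s, F r (picard F t x u v m r) (u r) (v r) := by
  rw [intervalIntegral.integral_of_le hs, picard]

theorem norm_picard_sub_le [Nonempty U] [Nonempty V] (hf : IsRegular T f C K) (hT : 0 ≤ T)
    {L : ℝ} (hL1 : 1 ≤ L) (hLK : K ≤ L)
    {u : ℝ → U} {v : ℝ → V} (hu : Measurable u) (hv : Measurable v) (t : ℝ)
    (x : EuclideanSpace ℝ (Fin d)) (m : ℕ) :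
    ∀ s, t ≤ s → ‖picard (frozen T hT f) t x u v (m + 1) s - picard (frozen T hT f) t x u v m s‖
      ≤ C * (1 / 2) ^ m * Real.exp (2 * L * (s - t)) := by
  have hC := hf.nonneg
  have hi : ∀ m s, t ≤ s → IntervalIntegrable (fun r => frozen T hT f r
      (picard (frozen T hT f) t x u v m r) (u r) (v r)) volume t s := fun m s hs =>
    hf.intervalIntegrable_frozen hT ((continuousOn_picard hf hT hu hv t x m).mono (by
      rw [uIcc_of_le hs]; exact Icc_subset_Ici_self)) hu hv
  induction m with
  | zero =>
    intro s hs
    rw [picard_succ_eq hs, picard, add_sub_cancel_left]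
    have := intervalIntegral.norm_integral_le_of_norm_le_const (a := t) (b := s) (C := C)
      (f := fun r => frozen T hT f r x (u r) (v r)) fun r _ => hf.bdd _ _ _ _
    refine this.trans ?_
    rw [abs_of_nonneg (by linarith), pow_zero, mul_one]
    refine mul_le_mul_of_nonneg_left ?_ hC
    have h1 := Real.add_one_le_exp (2 * L * (s - t))
    nlinarith
  | succ m ih =>
    intro s hs
    rw [picard_succ_eq hs, picard_succ_eq hs, add_sub_add_left_eq_sub,
      ← intervalIntegral.integral_sub (hi _ _ hs) (hi _ _ hs)]
    have hF : ∀ y ∈ uIcc t s, HasDerivAt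
        (fun r => C * (1 / 2) ^ (m + 1) * Real.exp (2 * L * (r - t)))
        (L * (C * (1 / 2) ^ m * Real.exp (2 * L * (y - t)))) y := by
      intro y _
      have h1 : HasDerivAt (fun r => 2 * L * (r - t)) (2 * L) y := by
        simpa using ((hasDerivAt_id y).sub_const t).const_mul (2 * L)
      exact (h1.exp.const_mul (C * (1 / 2) ^ (m + 1))).congr_deriv (by ring)
    have hcont : Continuous fun y => L * (C * (1 / 2) ^ m * Real.exp (2 * L * (y - t))) := by
      fun_prop
    have hI := intervalIntegral.integral_eq_sub_of_hasDerivAt hF (hcont.intervalIntegrable _ _)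
    refine (intervalIntegral.norm_integral_le_of_norm_le hs (ae_of_all _ fun r hr => ?_)
      (hcont.intervalIntegrable _ _)).trans ?_
    · refine (hf.lip _ _ _ _ _).trans ?_
      exact mul_le_mul hLK (ih r hr.1.le) (norm_nonneg _) (by linarith)
    · rw [hI]
      have : 0 ≤ C * (1 / 2) ^ (m + 1) * Real.exp (2 * L * (t - t)) := by positivity
      linarith

theorem exists_isSol_of_measurable [Nonempty U] [Nonempty V] (hf : IsRegular T f C K)
    {t : ℝ} (ht : t ∈ Icc 0 T) {Ω : Type*} [MeasurableSpace Ω]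
    {u : ℝ → Ω → U} {v : ℝ → Ω → V} (hu : Measurable (Function.uncurry u))
    (hv : Measurable (Function.uncurry v)) (x : EuclideanSpace ℝ (Fin d)) :
    ∃ X : ℝ → Ω → EuclideanSpace ℝ (Fin d), Measurable (Function.uncurry X) ∧
      ∀ ω, IsSol f T t x (fun r => u r ω) (fun r => v r ω) (fun s => X s ω) := by
  have hT : 0 ≤ T := ht.1.trans ht.2
  set L := max K 1
  set Y : ℕ → ℝ × Ω → EuclideanSpace ℝ (Fin d) := fun m p =>
    picard (frozen T hT f) t x (fun r => u r p.2) (fun r => v r p.2) m (max t p.1) with hY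
  have hYm : ∀ m, Measurable (Y m) := fun m =>
    (measurable_picard hf hT hu hv t x m).comp
      (g := fun p : ℝ × Ω => picard (frozen T hT f) t x (fun r => u r p.2) (fun r => v r p.2) m p.1)
      (f := fun p : ℝ × Ω => (max t p.1, p.2)) (by fun_prop)
  have hu' : ∀ ω, Measurable fun r => u r ω := fun ω => hu.comp (by fun_prop :
    Measurable fun r : ℝ => (r, ω))
  have hv' : ∀ ω, Measurable fun r => v r ω := fun ω => hv.comp (by fun_prop :
    Measurable fun r : ℝ => (r, ω))
  have hdist : ∀ p m, dist (Y m p) (Y (m + 1) p)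
      ≤ C * Real.exp (2 * L * (max t p.1 - t)) * (1 / 2) ^ m := by
    intro p m
    rw [dist_comm, dist_eq_norm]
    refine (norm_picard_sub_le hf hT (le_max_right K 1) (le_max_left K 1) (hu' p.2) (hv' p.2) t x m
      _ (le_max_left t p.1)).trans (le_of_eq (by ring))
  have hcau : ∀ p, ∃ y, Tendsto (fun m => Y m p) atTop (𝓝 y) := fun p =>
    cauchySeq_tendsto_of_complete (cauchySeq_of_le_geometric _ _ (by norm_num) (hdist p))
  choose Z hZ using hcau
  have hZm : Measurable Z := measurable_of_tendsto_metrizable hYm (tendsto_pi_nhds.2 hZ)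
  refine ⟨fun s ω => Z (s, ω), hZm, fun ω => ?_⟩
  rw [← isSol_frozen_iff hT ht.1]
  have hlim : ∀ s, t ≤ s → Tendsto (fun m => picard (frozen T hT f) t x (fun r => u r ω)
      (fun r => v r ω) m s) atTop (𝓝 (Z (s, ω))) := by
    intro s hs
    have := hZ (s, ω)
    simpa only [hY, max_eq_right hs] using this
  have hmeas : Measurable fun r => frozen T hT f r (Z (r, ω)) (u r ω) (v r ω) :=
    hf.measurable_frozen_comp hT measurable_id (hZm.comp (by fun_prop)) (hu' ω) (hv' ω)
  have hint : ∀ s, t ≤ s → Z (s, ω)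
      = x + ∫ r in t..s, frozen T hT f r (Z (r, ω)) (u r ω) (v r ω) := by
    intro s hs
    refine tendsto_nhds_unique ((tendsto_add_atTop_iff_nat 1).2 (hlim s hs)) ?_
    simp_rw [picard_succ_eq hs]
    refine tendsto_const_nhds.add ?_
    refine intervalIntegral.tendsto_integral_filter_of_dominated_convergence (fun _ => C) ?_ ?_ ?_ ?_
    · refine Eventually.of_forall fun m => Measurable.aestronglyMeasurable ?_
      refine hf.measurable_frozen_comp hT measurable_id ?_ (hu' ω) (hv' ω)
      exact (measurable_picard hf hT hu hv t x m).comp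
        (by fun_prop : Measurable fun r : ℝ => (r, ω))
    · exact Eventually.of_forall fun m => ae_of_all _ fun r _ => hf.bdd _ _ _ _
    · exact intervalIntegrable_const
    · refine ae_of_all _ fun r hr => ?_
      rw [uIoc_of_le hs] at hr
      have hc : Continuous fun y => frozen T hT f r y (u r ω) (v r ω) :=
        (hf.continuous_frozen hT).comp (by fun_prop :
          Continuous fun y : EuclideanSpace ℝ (Fin d) => (r, y, u r ω, v r ω))
      exact (hc.tendsto _).comp (hlim r hr.1.le)
  refine ⟨?_, fun s hs => hint s hs.1⟩
  have : ContinuousOn (fun s => x + ∫ r in t..s, frozen T hT f r (Z (r, ω)) (u r ω) (v r ω))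
      (Icc t T) := by
    refine continuousOn_const.add ?_
    rw [← uIcc_of_le ht.2]
    apply intervalIntegral.continuousOn_primitive_interval
    have : IsFiniteMeasure (volume.restrict (uIcc t T)) := by
      rw [uIcc]; infer_instance
    exact Integrable.of_bound (C := C) hmeas.aestronglyMeasurable
      (ae_of_all _ fun r => hf.bdd _ _ _ _)
  exact this.congr fun s hs => hint s hs.1

theorem isSol_sol [Nonempty U] [Nonempty V] (hf : IsRegular T f C K)
    {t : ℝ} (ht : t ∈ Icc 0 T) {u : ℝ → U} {v : ℝ → V} (hu : Measurable u) (hv : Measurable v)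
    (x : EuclideanSpace ℝ (Fin d)) : IsSol f T t x u v (sol f T t x u v) := by
  obtain ⟨X, -, hX⟩ := exists_isSol_of_measurable hf ht (Ω := Unit) (u := fun r _ => u r)
    (v := fun r _ => v r) (hu.comp measurable_fst) (hv.comp measurable_fst) x
  exact Classical.epsilon_spec (p := IsSol f T t x u v) ⟨_, hX ()⟩

/-- The state at time `s`, for jointly measurable controls. -/
theorem measurable_sol [Nonempty U] [Nonempty V] (hf : IsRegular T f C K)
    {t : ℝ} (ht : 0 ≤ t) {Ω : Type*} [MeasurableSpace Ω]
    {u : ℝ → Ω → U} {v : ℝ → Ω → V} (hu : Measurable (Function.uncurry u))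
    (hv : Measurable (Function.uncurry v)) (x : EuclideanSpace ℝ (Fin d)) :
    Measurable fun p : Icc t T × Ω => sol f T t x (fun r => u r p.2) (fun r => v r p.2) p.1 := by
  rcases le_or_gt t T with htT | htT
  swap
  · have : IsEmpty (Icc t T × Ω) := ⟨fun p => absurd (p.1.2.1.trans p.1.2.2) (not_le.2 htT)⟩
    exact measurable_of_empty _
  have hu' : ∀ ω, Measurable fun r => u r ω := fun ω => hu.comp (by fun_prop :
    Measurable fun r : ℝ => (r, ω))
  have hv' : ∀ ω, Measurable fun r => v r ω := fun ω => hv.comp (by fun_prop :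
    Measurable fun r : ℝ => (r, ω))
  obtain ⟨X, hXm, hX⟩ := exists_isSol_of_measurable hf ⟨ht, htT⟩ hu hv x
  have : (fun p : Icc t T × Ω => sol f T t x (fun r => u r p.2) (fun r => v r p.2) p.1)
      = fun p => Function.uncurry X (p.1, p.2) := by
    funext p
    exact (isSol_sol hf ⟨ht, htT⟩ (hu' p.2) (hv' p.2) x).congr_controls hf ht le_rfl (hX p.2)
      (hu' _) (hv' _) (hu' _) (hv' _) (ae_of_all _ fun _ _ => rfl) (ae_of_all _ fun _ _ => rfl)
      _ p.1.2
  rw [this]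
  exact hXm.comp (by fun_prop)

end Picard

/-! ### The sample space -/

section SampleSpace

theorem IsProductMeasure.eq_infinitePi {P : Measure Omega} (hP : IsProductMeasure P) :
    P = Measure.infinitePi fun _ : ℕ => (volume : Measure (I × I)) := by
  refine Measure.eq_infinitePi _ fun s t ht => ?_
  obtain ⟨m, hm⟩ : ∃ m, s ⊆ Finset.range m := s.exists_nat_subset_range
  classical
  set B : Fin m → Set (I × I) := fun i => if (i : ℕ) ∈ s then t i else univ with hB
  have hBm : ∀ i, MeasurableSet (B i) := by
    intro i
    simp only [hB]
    split_ifs with h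
    exacts [ht _, .univ]
  have hset : (s : Set ℕ).pi t = (fun (ω : Omega) (i : Fin m) => ω (i : ℕ)) ⁻¹' (univ.pi B) := by
    ext ω
    simp only [Set.mem_pi, Finset.mem_coe, mem_preimage, mem_univ, true_implies, hB]
    constructor
    · intro h i
      split_ifs with hi
      exacts [h _ hi, mem_univ _]
    · intro h i hi
      have := h ⟨i, Finset.mem_range.1 (hm hi)⟩
      simpa [hi] using this
  rw [hset, ← Measure.map_apply (by fun_prop) (MeasurableSet.univ_pi hBm), hP m, Measure.pi_pi]
  have h1 : ∏ i : Fin m, volume (B i) = ∏ i ∈ Finset.range m, if i ∈ s then volume (t i) else 1 := by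
    rw [Finset.prod_range]
    refine Finset.prod_congr rfl fun i _ => ?_
    simp only [hB]
    split_ifs <;> simp
  rw [h1, Finset.prod_ite_mem, Finset.inter_eq_right.2 hm]

theorem Fsig_le (k : ℕ) : Fsig k ≤ (inferInstance : MeasurableSpace Omega) :=
  Measurable.comap_le (by fun_prop)

/-- Keep the first `k` coordinates and reset the others. -/
def truncate (k : ℕ) (ω : Omega) : Omega := fun i => if i < k then ω i else (0, 0)

theorem measurable_truncate (k : ℕ) : Measurable[Fsig k] (truncate k) := by
  refine @measurable_pi_lambda _ _ _ (Fsig k) _ _ fun i => ?_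
  by_cases hi : i < k
  · have h : (fun ω : Omega => truncate k ω i)
        = (fun x : Fin k → I × I => x ⟨i, hi⟩) ∘ fun ω (i : Fin k) => ω (i : ℕ) := by
      funext ω; simp [truncate, hi]
    rw [h]
    exact (measurable_pi_apply _).comp (comap_measurable _)
  · have h : (fun ω : Omega => truncate k ω i) = fun _ => (0, 0) := by
      funext ω; simp [truncate, hi]
    rw [h]
    exact measurable_const

/-- A measurable map depending only on the first `k` coordinates is `𝓕_k`-measurable. -/
theorem measurable_Fsig_of_forall_eq {β : Type*} [MeasurableSpace β] {k : ℕ} {h : Omega → β}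
    (hm : Measurable h) (hdep : ∀ ω ω' : Omega, (∀ i < k, ω i = ω' i) → h ω = h ω') :
    Measurable[Fsig k] h := by
  have : h = h ∘ truncate k := by
    funext ω
    exact hdep _ _ fun i hi => by simp [truncate, hi]
  rw [this]
  exact hm.comp (measurable_truncate k)

theorem mem_iff_of_measurableSet_Fsig {k : ℕ} {A : Set Omega} (hA : MeasurableSet[Fsig k] A)
    {ω ω' : Omega} (h : ∀ i < k, ω i = ω' i) : ω ∈ A ↔ ω' ∈ A := by
  obtain ⟨B, -, rfl⟩ := hA
  have : (fun i : Fin k => ω (i : ℕ)) = fun i : Fin k => ω' (i : ℕ) := by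
    funext i; exact h i i.2
  simp only [mem_preimage, this]

theorem Fsig_mono {j k : ℕ} (hjk : j ≤ k) : Fsig j ≤ Fsig k := by
  intro A hA
  have h : A = truncate k ⁻¹' A := by
    ext ω
    exact mem_iff_of_measurableSet_Fsig hA fun i hi => by simp [truncate, hi.trans_le hjk]
  rw [h]
  exact measurable_truncate k (Fsig_le j A hA)

theorem eq_of_measurable_comap {α β γ : Type*} [MeasurableSpace β] [MeasurableSingletonClass β]
    [MeasurableSpace γ] {c : α → γ} {w : α → β}
    (hw : Measurable[MeasurableSpace.comap c inferInstance] w) {a a' : α} (h : c a = c a') :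
    w a = w a' := by
  obtain ⟨B, -, hB⟩ := hw (measurableSet_singleton (w a'))
  have h' : a' ∈ c ⁻¹' B := by rw [hB]; rfl
  have : a ∈ c ⁻¹' B := by rw [mem_preimage, h]; exact h'
  rw [hB] at this
  exact this

theorem measurePreserving_pi_map {P : Measure Omega} (hP : IsProductMeasure P)
    {g : ℕ → I × I → I × I} (hg : ∀ i, MeasurePreserving (g i)) :
    MeasurePreserving (fun (ω : Omega) i => g i (ω i)) P P := by
  have hm : Measurable fun (ω : Omega) i => g i (ω i) :=
    measurable_pi_lambda _ fun i => (hg i).measurable.comp (measurable_pi_apply i)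
  refine ⟨hm, ?_⟩
  rw [hP.eq_infinitePi]
  refine Measure.eq_infinitePi _ fun s t ht => ?_
  rw [Measure.map_apply hm (MeasurableSet.pi (Finset.countable_toSet s) fun i _ => ht i)]
  have : (fun (ω : Omega) i => g i (ω i)) ⁻¹' (s : Set ℕ).pi t
      = (s : Set ℕ).pi fun i => g i ⁻¹' t i := by
    ext ω; simp
  rw [this, Measure.infinitePi_pi _ fun i _ => (hg i).measurable (ht i)]
  exact Finset.prod_congr rfl fun i _ => (hg i).measure_preimage (ht i).nullMeasurableSet

theorem measurePreserving_update {P : Measure Omega} [IsProbabilityMeasure P]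
    (hP : IsProductMeasure P) (j : ℕ) :
    MeasurePreserving (fun p : Omega × (I × I) => Function.update p.1 j p.2)
      (P.prod volume) P := by
  have hm : Measurable fun p : Omega × (I × I) => Function.update p.1 j p.2 := by
    refine measurable_pi_lambda _ fun i => ?_
    by_cases hi : i = j
    · subst hi; simpa using measurable_snd
    · simp only [Function.update_of_ne hi]; fun_prop
  refine ⟨hm, ?_⟩
  conv_rhs => rw [hP.eq_infinitePi]
  refine Measure.eq_infinitePi _ fun s t ht => ?_
  rw [Measure.map_apply hm (MeasurableSet.pi (Finset.countable_toSet s) fun i _ => ht i)]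
  have hpi : ∀ s' : Finset ℕ, P ((s' : Set ℕ).pi t) = ∏ i ∈ s', volume (t i) := by
    intro s'
    conv_lhs => rw [hP.eq_infinitePi]
    exact Measure.infinitePi_pi _ fun i _ => ht i
  by_cases hj : j ∈ s
  · have : (fun p : Omega × (I × I) => Function.update p.1 j p.2) ⁻¹' (s : Set ℕ).pi t
        = ((s.erase j : Finset ℕ) : Set ℕ).pi t ×ˢ t j := by
      ext p
      simp only [mem_preimage, Set.mem_pi, Finset.mem_coe, mem_prod, Finset.mem_erase]
      constructor
      · intro h
        refine ⟨fun i hi => ?_, by simpa using h j hj⟩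
        simpa [hi.1] using h i hi.2
      · rintro ⟨h1, h2⟩ i hi
        by_cases hij : i = j
        · subst hij; simpa using h2
        · simpa [hij] using h1 i ⟨hij, hi⟩
    rw [this, Measure.prod_prod, hpi, Finset.prod_erase_mul _ _ hj]
  · have : (fun p : Omega × (I × I) => Function.update p.1 j p.2) ⁻¹' (s : Set ℕ).pi t
        = (s : Set ℕ).pi t ×ˢ univ := by
      ext p
      simp only [mem_preimage, Set.mem_pi, Finset.mem_coe, mem_prod, mem_univ, and_true]
      refine forall₂_congr fun i hi => ?_
      rw [Function.update_of_ne (by rintro rfl; exact hj hi)]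
    rw [this, Measure.prod_prod, hpi, measure_univ, mul_one]

/-- Rotation of the half-open unit interval, leaving the end point `1` fixed. -/
def rotI (c : ℝ) (x : I) : I :=
  if x = 1 then 1 else ⟨Int.fract (x + c), Int.fract_nonneg _, (Int.fract_lt_one _).le⟩

theorem rotI_neg_rotI (c : ℝ) (x : I) : rotI (-c) (rotI c x) = x := by
  by_cases hx : x = 1
  · simp [rotI, hx]
  · have h1 : rotI c x ≠ 1 := by
      rw [rotI, if_neg hx]
      intro h
      exact (Int.fract_lt_one ((x : ℝ) + c)).ne (congrArg Subtype.val h)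
    have h2 : ((rotI c x : I) : ℝ) = Int.fract ((x : ℝ) + c) := by rw [rotI, if_neg hx]
    have hx1 : (x : ℝ) < 1 := lt_of_le_of_ne x.2.2 fun h => hx (Subtype.ext h)
    have h3 : Int.fract (Int.fract ((x : ℝ) + c) + -c) = x := by
      rw [Int.fract_eq_iff]
      exact ⟨x.2.1, hx1, -⌊(x : ℝ) + c⌋, by rw [Int.fract]; push_cast; ring⟩
    rw [rotI, if_neg h1]
    exact Subtype.ext (by simp only [h2, h3])

theorem measurable_rotI : Measurable fun p : ℝ × I => rotI p.1 p.2 := by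
  refine Measurable.ite (measurable_snd (measurableSet_singleton 1)) measurable_const ?_
  exact Measurable.subtype_mk (measurable_fract.comp (by fun_prop))

theorem measurePreserving_fract_add (c : ℝ) :
    MeasurePreserving (fun x : I =>
      (⟨Int.fract (x + c), Int.fract_nonneg _, (Int.fract_lt_one _).le⟩ : I)) := by
  have hm : Measurable (fun x : I =>
      (⟨Int.fract (x + c), Int.fract_nonneg _, (Int.fract_lt_one _).le⟩ : I)) :=
    Measurable.subtype_mk (measurable_fract.comp (by fun_prop))
  refine ⟨hm, Measure.ext fun A hA => ?_⟩
  rw [Measure.map_apply hm hA, ← measureReal_eq_measureReal_iff]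
  set g : ℝ → ℝ := fun y =>
    A.indicator 1 (⟨Int.fract y, Int.fract_nonneg _, (Int.fract_lt_one _).le⟩ : I) with hg
  have hper : Function.Periodic g 1 := fun y => by simp only [hg, Int.fract_add_one]
  have hI : ∀ F : ℝ → ℝ, ∫ x : I, F x = ∫ x in (0 : ℝ)..1, F x := fun F => by
    rw [intervalIntegral.integral_of_le zero_le_one, ← integral_Icc_eq_integral_Ioc]
    exact integral_subtype measurableSet_Icc F
  have e1 : ∫ x : I, g (x + c) = ∫ x : I, g x := by
    rw [hI (fun x => g (x + c)), hI g, intervalIntegral.integral_comp_add_right, zero_add,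
      add_comm 1 c, hper.intervalIntegral_add_eq c 0, zero_add]
  have e2 : ∫ x : I, g (x + c) = volume.real ((fun x : I =>
      (⟨Int.fract (x + c), Int.fract_nonneg _, (Int.fract_lt_one _).le⟩ : I)) ⁻¹' A) := by
    rw [← integral_indicator_one (hm hA)]
    rfl
  have e3 : ∫ x : I, g x = volume.real A := by
    rw [← integral_indicator_one hA]
    refine integral_congr_ae ?_
    filter_upwards [compl_mem_ae_iff.2 (measure_singleton (1 : I))] with x hx
    have hx1 : (x : ℝ) < 1 := lt_of_le_of_ne x.2.2 fun h => hx (Subtype.ext h)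
    simp only [hg, Int.fract_eq_self.2 ⟨x.2.1, hx1⟩]
  rw [← e2, ← e3, e1]

theorem measurePreserving_rotI (c : ℝ) : MeasurePreserving (rotI c) := by
  refine ⟨measurable_rotI.comp (by fun_prop : Measurable fun x : I => (c, x)), ?_⟩
  refine (Measure.map_congr ?_).trans (measurePreserving_fract_add c).map_eq
  filter_upwards [compl_mem_ae_iff.2 (measure_singleton (1 : I))] with x hx
  exact if_neg hx

theorem measurePreserving_rotI_swap {x : I} (hx : x ≠ 1) :
    MeasurePreserving (fun c : I => rotI c x) := by
  have : (fun c : I => rotI c x) = fun c : I =>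
      (⟨Int.fract (c + x), Int.fract_nonneg _, (Int.fract_lt_one _).le⟩ : I) := by
    funext c
    rw [rotI, if_neg hx]
    simp only [add_comm]
  rw [this]
  exact measurePreserving_fract_add x

/-- Rotation of the first `k` coordinates of the sample space. -/
def rot (k : ℕ) (c : ℕ → ℝ × ℝ) (ω : Omega) : Omega :=
  fun i => if i < k then (rotI (c i).1 (ω i).1, rotI (c i).2 (ω i).2) else ω i

theorem rot_neg_rot (k : ℕ) (c : ℕ → ℝ × ℝ) (ω : Omega) : rot k (-c) (rot k c ω) = ω := by
  funext i
  by_cases hi : i < k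
  · simp [rot, hi, rotI_neg_rotI]
  · simp [rot, hi]

theorem rot_rot_neg (k : ℕ) (c : ℕ → ℝ × ℝ) (ω : Omega) : rot k c (rot k (-c) ω) = ω := by
  simpa using rot_neg_rot k (-c) ω

theorem measurePreserving_rot {P : Measure Omega} (hP : IsProductMeasure P) (k : ℕ)
    (c : ℕ → ℝ × ℝ) : MeasurePreserving (rot k c) P P := by
  refine measurePreserving_pi_map hP (g := fun i x =>
    if i < k then (rotI (c i).1 x.1, rotI (c i).2 x.2) else x) fun i => ?_
  by_cases hi : i < k
  · simp only [hi, if_true]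
    exact (measurePreserving_rotI _).prod (measurePreserving_rotI _)
  · simp only [hi, if_false]
    exact MeasurePreserving.id _

theorem measurable_rot_Fsig (k : ℕ) (c : ℕ → ℝ × ℝ) (j : ℕ) :
    Measurable[Fsig j, Fsig j] (rot k c) := by
  rw [measurable_iff_comap_le]
  have h : (fun (ω : Omega) (i : Fin j) => ω (i : ℕ)) ∘ rot k c
      = (fun (x : Fin j → I × I) (i : Fin j) =>
        if (i : ℕ) < k then (rotI (c i).1 (x i).1, rotI (c i).2 (x i).2) else x i)
        ∘ fun (ω : Omega) (i : Fin j) => ω (i : ℕ) := rfl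
  rw [Fsig, MeasurableSpace.comap_comp, h, ← MeasurableSpace.comap_comp]
  refine MeasurableSpace.comap_mono (Measurable.comap_le ?_)
  refine measurable_pi_lambda _ fun i => ?_
  split_ifs
  · exact (measurable_rotI.comp (f := fun x : Fin j → I × I => ((c i).1, (x i).1))
      (by fun_prop)).prodMk (measurable_rotI.comp (f := fun x : Fin j → I × I =>
        ((c i).2, (x i).2)) (by fun_prop))
  · fun_prop

theorem measurable_rot_Gsig (k : ℕ) (c : ℕ → ℝ × ℝ) (j : ℕ) :
    Measurable[Gsig j, Gsig j] (rot k c) := by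
  rw [measurable_iff_comap_le]
  have h : (fun ω : Omega => (ω j).1) ∘ rot k c
      = (fun x : I => if j < k then rotI (c j).1 x else x) ∘ fun ω : Omega => (ω j).1 := by
    funext ω
    simp only [Function.comp, rot]
    split_ifs <;> rfl
  rw [Gsig, MeasurableSpace.comap_comp, h, ← MeasurableSpace.comap_comp]
  refine MeasurableSpace.comap_mono (Measurable.comap_le ?_)
  split_ifs
  · exact (measurePreserving_rotI _).measurable
  · exact measurable_id

theorem measurable_rot_Hsig (k : ℕ) (c : ℕ → ℝ × ℝ) (j : ℕ) :
    Measurable[Hsig j, Hsig j] (rot k c) := by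
  rw [measurable_iff_comap_le]
  have h : (fun ω : Omega => (ω j).2) ∘ rot k c
      = (fun x : I => if j < k then rotI (c j).2 x else x) ∘ fun ω : Omega => (ω j).2 := by
    funext ω
    simp only [Function.comp, rot]
    split_ifs <;> rfl
  rw [Hsig, MeasurableSpace.comap_comp, h, ← MeasurableSpace.comap_comp]
  refine MeasurableSpace.comap_mono (Measurable.comap_le ?_)
  split_ifs
  · exact (measurePreserving_rotI _).measurable
  · exact measurable_id

theorem measurable_rot_uncurry (k : ℕ) :
    Measurable fun p : Omega × Omega => rot k (fun i => ((p.1 i).1, (p.1 i).2)) p.2 := by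
  refine measurable_pi_lambda _ fun i => ?_
  by_cases hi : i < k
  · simp only [rot, hi, if_true]
    exact (measurable_rotI.comp (f := fun p : Omega × Omega => (((p.1 i).1 : ℝ), (p.2 i).1))
      (by fun_prop)).prodMk (measurable_rotI.comp (f := fun p : Omega × Omega =>
        (((p.1 i).2 : ℝ), (p.2 i).2)) (by fun_prop))
  · simp only [rot, hi, if_false]
    fun_prop

theorem ae_coord_ne_one {P : Measure Omega} (hP : IsProductMeasure P) :
    ∀ᵐ ω ∂P, ∀ i, (ω i).1 ≠ 1 ∧ (ω i).2 ≠ 1 := by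
  rw [ae_all_iff]
  intro i
  have h1 : ∀ᵐ y ∂(volume : Measure (I × I)), y.1 ≠ 1 ∧ y.2 ≠ 1 := by
    have e : ∀ᵐ x ∂(volume : Measure I), x ≠ 1 := Measure.ae_ne volume 1
    rw [Measure.volume_eq_prod]
    have e1 : ∀ᵐ y ∂((volume : Measure I).prod (volume : Measure I)), y.1 ≠ 1 :=
      (Measure.quasiMeasurePreserving_fst (μ := (volume : Measure I))
        (ν := (volume : Measure I))).ae e
    have e2 : ∀ᵐ y ∂((volume : Measure I).prod (volume : Measure I)), y.2 ≠ 1 :=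
      (Measure.quasiMeasurePreserving_snd (μ := (volume : Measure I))
        (ν := (volume : Measure I))).ae e
    exact e1.and e2
  have h2 : MeasurePreserving (fun ω : Omega => ω i) P volume := by
    rw [hP.eq_infinitePi]
    exact measurePreserving_eval_infinitePi _ i
  exact h2.quasiMeasurePreserving.ae h1

/-- An `𝓕_k`-measurable bounded function which does not increase under the rotations of the first
`k` coordinates is bounded below by its mean. -/
theorem integral_le_of_comp_rot_le {P : Measure Omega} [IsProbabilityMeasure P]
    (hP : IsProductMeasure P) {k : ℕ} {S : Omega → ℝ} (hS : Measurable[Fsig k] S)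
    {B : ℝ} (hB : ∀ ω, |S ω| ≤ B) (hrot : ∀ c, ∀ᵐ ω ∂P, S (rot k c ω) ≤ S ω) :
    ∀ᵐ ω ∂P, ∫ η, S η ∂P ≤ S ω := by
  have hSm : Measurable S := hS.mono (Fsig_le k) le_rfl
  have hprod : ∀ᵐ p ∂(P.prod P), S (rot k (fun i => ((p.1 i).1, (p.1 i).2)) p.2) ≤ S p.2 := by
    have m1 : Measurable fun p : Omega × Omega =>
      S (rot k (fun i => ((p.1 i).1, (p.1 i).2)) p.2) := hSm.comp (measurable_rot_uncurry k)
    have m2 : Measurable fun p : Omega × Omega => S p.2 := hSm.comp measurable_snd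
    have h := fun η : Omega => hrot fun i => (((η i).1 : ℝ), ((η i).2 : ℝ))
    exact (Measure.ae_prod_iff_ae_ae (measurableSet_le m1 m2)).2 (ae_of_all _ h)
  have hswap := Measure.ae_ae_of_ae_prod
    ((Measure.measurePreserving_swap (μ := P) (ν := P)).quasiMeasurePreserving.ae hprod)
  filter_upwards [hswap, ae_coord_ne_one hP] with ω h1 h2
  have hmp : MeasurePreserving (fun (η : Omega) i =>
      if i < k then (rotI (η i).1 (ω i).1, rotI (η i).2 (ω i).2) else η i) P P := by
    refine measurePreserving_pi_map hP (g := fun i x =>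
      if i < k then (rotI x.1 (ω i).1, rotI x.2 (ω i).2) else x) fun i => ?_
    by_cases hi : i < k
    · simp only [hi, if_true]
      exact (measurePreserving_rotI_swap (h2 i).1).prod (measurePreserving_rotI_swap (h2 i).2)
    · simp only [hi, if_false]
      exact MeasurePreserving.id _
  have hint : ∀ g : Omega → Omega, Measurable g → Integrable (fun η => S (g η)) P := fun g hg =>
    Integrable.of_bound (C := B) (hSm.comp hg).aestronglyMeasurable
      (ae_of_all _ fun η => hB _)
  have e : ∫ η, S η ∂P = ∫ η, S (fun i =>
      if i < k then (rotI (η i).1 (ω i).1, rotI (η i).2 (ω i).2) else η i) ∂P := by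
    rw [← integral_map hmp.measurable.aemeasurable (by rw [hmp.map_eq]; exact
      hSm.aestronglyMeasurable), hmp.map_eq]
  rw [e]
  have hle : ∫ η, S (fun i =>
      if i < k then (rotI (η i).1 (ω i).1, rotI (η i).2 (ω i).2) else η i) ∂P
      ≤ ∫ _, S ω ∂P := by
    refine integral_mono_ae (hint _ hmp.measurable) (integrable_const _) ?_
    filter_upwards [h1] with η hη
    refine le_trans (le_of_eq ?_) hη
    refine eq_of_measurable_comap (c := fun ω (i : Fin k) => ω (i : ℕ)) hS ?_
    funext i
    simp [rot]
  simpa using hle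

end SampleSpace

/-! ### Partitions -/

namespace Partition

variable {T : ℝ} (π : Partition T)

theorem t_lt {i j : ℕ} (hij : i < j) (hj : j ≤ π.n) : π.t i < π.t j := by
  induction j, hij using Nat.le_induction with
  | base => exact π.mono i hj
  | succ m hm ih => exact (ih (by omega)).trans (π.mono m hj)

theorem t_le {i j : ℕ} (hij : i ≤ j) (hj : j ≤ π.n) : π.t i ≤ π.t j := by
  rcases hij.eq_or_lt with rfl | h
  exacts [le_rfl, (π.t_lt h hj).le]

theorem t_mem {i : ℕ} (hi : i ≤ π.n) : π.t i ∈ Icc 0 T :=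
  ⟨π.map_zero.symm.le.trans (π.t_le (Nat.zero_le i) hi), (π.t_le hi le_rfl).trans π.map_last.le⟩

theorem idx_lt (s : ℝ) : π.idx s < π.n :=
  (Nat.findGreatest_le _).trans_lt (Nat.sub_lt π.npos one_pos)

theorem t_idx_le {s : ℝ} (hs : 0 ≤ s) : π.t (π.idx s) ≤ s := by
  classical
  unfold idx
  have := Nat.findGreatest_spec (P := fun i => π.t i ≤ s) (Nat.zero_le (π.n - 1))
    (by rw [π.map_zero]; exact hs)
  convert this

theorem le_idx {s : ℝ} {k : ℕ} (hk : k < π.n) (hs : π.t k ≤ s) : k ≤ π.idx s :=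
  Nat.le_findGreatest (by omega) hs

theorem lt_t_idx_succ {s : ℝ} (hs : s < T) : s < π.t (π.idx s + 1) := by
  by_contra! h
  have h1 := π.idx_lt s
  by_cases h2 : π.idx s + 1 < π.n
  · exact absurd (π.le_idx h2 h) (by omega)
  · have : π.idx s + 1 = π.n := by omega
    rw [this, π.map_last] at h
    exact absurd h hs.not_ge

theorem idx_eq {s : ℝ} {k : ℕ} (hk : k < π.n) (hs : s ∈ Ico (π.t k) (π.t (k + 1))) :
    π.idx s = k := by
  refine le_antisymm ?_ (π.le_idx hk hs.1)
  by_contra! h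
  have h0 : 0 ≤ s := (π.t_mem hk.le).1.trans hs.1
  exact absurd ((π.t_le h (π.idx_lt s).le).trans (π.t_idx_le h0)) hs.2.not_ge

theorem idx_t {k : ℕ} (hk : k < π.n) : π.idx (π.t k) = k :=
  π.idx_eq hk ⟨le_rfl, π.mono k hk⟩

theorem sub_le_mesh {i : ℕ} (hi : i < π.n) : π.t (i + 1) - π.t i ≤ π.mesh :=
  Finset.le_sup' (fun i => π.t (i + 1) - π.t i) (Finset.mem_range.2 hi)

theorem measurable_idx : Measurable π.idx := by
  refine measurable_of_Ici fun k => ?_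
  by_cases hk : k = 0
  · subst hk
    have : π.idx ⁻¹' Ici 0 = univ := by ext; simp
    rw [this]; exact .univ
  by_cases hn : k < π.n
  · have : π.idx ⁻¹' Ici k = Ici (π.t k) := by
      ext s
      refine ⟨fun h => ?_, fun h => π.le_idx hn h⟩
      have h1 : k ≤ π.idx s := h
      have h0 : π.t (π.idx s) ≤ s := by
        have : π.idx s ≠ 0 := by omega
        classical
        have := Nat.findGreatest_of_ne_zero (P := fun i => π.t i ≤ s) (n := π.n - 1)
          (m := π.idx s) (by unfold idx; congr) this
        exact this
      exact (π.t_le h1 (π.idx_lt s).le).trans h0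
    rw [this]; exact measurableSet_Ici
  · have : π.idx ⁻¹' Ici k = ∅ := by
      ext s
      simpa using (π.idx_lt s).trans_le (not_lt.1 hn)
    rw [this]; exact .empty

end Partition

/-! ### Admissible controls -/

section Controls

/-- On the time set `S`, the process `u` is a countable `𝓕`-measurable pasting of processes whose
time sections are `𝓖`-measurable. -/
def IsPasting {E : Type*} [MeasurableSpace E] (𝓕 𝓖 : MeasurableSpace Omega) (S : Set ℝ)
    (u : ℝ → Omega → E) : Prop :=
  ∃ (Γ : ℕ → Set Omega) (w : ℕ → ℝ → Omega → E),
    (∀ k, MeasurableSet[𝓕] (Γ k)) ∧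
    Pairwise (Function.onFun Disjoint Γ) ∧
    (⋃ k, Γ k) = univ ∧
    (∀ k s, Measurable[𝓖] (w k s)) ∧
    (∀ k, ∀ ω ∈ Γ k, ∀ s ∈ S, u s ω = w k s ω)

namespace IsPasting

variable {E : Type*} [MeasurableSpace E] {𝓕 𝓖 : MeasurableSpace Omega} {S : Set ℝ}
  {u u' : ℝ → Omega → E}

theorem congr (h : IsPasting 𝓕 𝓖 S u) (he : ∀ s ∈ S, ∀ ω, u' s ω = u s ω) :
    IsPasting 𝓕 𝓖 S u' := by
  obtain ⟨Γ, w, h1, h2, h3, h4, h5⟩ := h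
  exact ⟨Γ, w, h1, h2, h3, h4, fun k ω hω s hs => (he s hs ω).trans (h5 k ω hω s hs)⟩

theorem of_measurable (h : ∀ s, Measurable[𝓖] (u s)) : IsPasting 𝓕 𝓖 S u := by
  refine ⟨fun k => if k = 0 then univ else ∅, fun _ => u, ?_, ?_, ?_, fun _ => h,
    fun _ _ _ _ _ => rfl⟩
  · intro k
    dsimp only
    split_ifs
    exacts [@MeasurableSet.univ _ 𝓕, @MeasurableSet.empty _ 𝓕]
  · intro i j hij
    simp only [Function.onFun]
    split_ifs with hi hj
    · omega
    all_goals simp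
  · exact eq_univ_of_forall fun ω => mem_iUnion.2 ⟨0, by simp⟩

theorem comp (h : IsPasting 𝓕 𝓖 S u) {τ : Omega → Omega} (h𝓕 : Measurable[𝓕, 𝓕] τ)
    (h𝓖 : Measurable[𝓖, 𝓖] τ) : IsPasting 𝓕 𝓖 S fun s ω => u s (τ ω) := by
  obtain ⟨Γ, w, h1, h2, h3, h4, h5⟩ := h
  refine ⟨fun k => τ ⁻¹' Γ k, fun k s ω => w k s (τ ω), fun k => h𝓕 (h1 k), fun i j hij =>
    (h2 hij).preimage τ, by rw [← preimage_iUnion, h3, preimage_univ],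
    fun k s => (h4 k s).comp h𝓖, fun k ω hω s hs => h5 k _ hω s hs⟩

theorem paste {v : ℕ → ℝ → Omega → E} (h : ∀ l, IsPasting 𝓕 𝓖 S (v l)) {N : Omega → ℕ}
    (hN : Measurable[𝓕] N) : IsPasting 𝓕 𝓖 S fun s ω => v (N ω) s ω := by
  choose Γ w h1 h2 h3 h4 h5 using h
  refine ⟨fun k => {ω | N ω = k.unpair.1} ∩ Γ k.unpair.1 k.unpair.2,
    fun k => w k.unpair.1 k.unpair.2, fun k => ?_, ?_, ?_, fun k s => h4 _ _ s, ?_⟩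
  · exact @MeasurableSet.inter _ 𝓕 _ _ (hN (measurableSet_singleton _)) (h1 _ _)
  · intro i j hij
    refine Set.disjoint_left.2 ?_
    rintro ω ⟨hi, hi'⟩ ⟨hj, hj'⟩
    have e1 : i.unpair.1 = j.unpair.1 := Eq.trans (Eq.symm hi) hj
    by_cases e2 : i.unpair.2 = j.unpair.2
    · exact hij (by rw [← Nat.pair_unpair i, ← Nat.pair_unpair j, e1, e2])
    · rw [e1] at hi'
      exact Set.disjoint_left.1 (h2 _ e2) hi' hj'
  · refine eq_univ_of_forall fun ω => ?_
    obtain ⟨m, hm⟩ := mem_iUnion.1 ((h3 (N ω)).symm ▸ mem_univ ω : ω ∈ ⋃ k, Γ (N ω) k)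
    refine mem_iUnion.2 ⟨Nat.pair (N ω) m, ?_⟩
    simp only [Nat.unpair_pair]
    exact ⟨rfl, hm⟩
  · rintro k ω ⟨hω, hω'⟩ s hs
    have : N ω = k.unpair.1 := hω
    dsimp only
    rw [this]
    exact h5 _ _ ω hω' s hs

end IsPasting

/-- Admissible controls along `π` for a player whose private randomisation at time `t_j` is
`𝓖 j`. -/
def Adm (𝓖 : ℕ → MeasurableSpace Omega) (E : Type*) [MeasurableSpace E] {T : ℝ}
    (π : Partition T) : Set (ℝ → Omega → E) :=
  {u | Measurable (Function.uncurry u) ∧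
    ∀ j < π.n, IsPasting (Fsig j) (𝓖 j) (Ico (π.t j) (π.t (j + 1))) u}

variable {E E' : Type*} [MeasurableSpace E] [MeasurableSpace E'] {T : ℝ} {π : Partition T}
  {𝓖 : ℕ → MeasurableSpace Omega}

theorem Adm.section_measurable {u : ℝ → Omega → E} (hu : u ∈ Adm 𝓖 E π) (ω : Omega) :
    Measurable fun s => u s ω :=
  hu.1.comp (by fun_prop : Measurable fun s : ℝ => (s, ω))

theorem const_mem_Adm (e : E) : (fun _ _ => e) ∈ Adm 𝓖 E π :=
  ⟨measurable_const, fun _ _ => .of_measurable fun _ => measurable_const⟩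

theorem concat_mem_Adm {u : ℝ → Omega → E} (hu : u ∈ Adm 𝓖 E π) {w : ℕ → ℝ → Omega → E}
    (hw : ∀ l, w l ∈ Adm 𝓖 E π) {k : ℕ} (hk : k ≤ π.n) {N : Omega → ℕ}
    (hN : Measurable[Fsig k] N) :
    (fun s ω => if s < π.t k then u s ω else w (N ω) s ω) ∈ Adm 𝓖 E π := by
  have hNm : Measurable N := hN.mono (Fsig_le k) le_rfl
  refine ⟨?_, fun j hj => ?_⟩
  · refine Measurable.ite (measurableSet_lt measurable_fst measurable_const) hu.1 ?_
    exact (measurable_from_prod_countable_right (f := fun p : ℕ × (ℝ × Omega) => w p.1 p.2.1 p.2.2)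
      fun l => (hw l).1).comp
        (g := fun p : ℕ × (ℝ × Omega) => w p.1 p.2.1 p.2.2)
        (f := fun p : ℝ × Omega => (N p.2, p)) (by fun_prop)
  · by_cases hjk : j < k
    · refine (hu.2 j hj).congr fun s hs ω => if_pos (hs.2.trans_le (π.t_le hjk hk))
    · refine (IsPasting.paste (fun l => (hw l).2 j hj)
        (hN.mono (Fsig_mono (not_lt.1 hjk)) le_rfl)).congr fun s hs ω => if_neg ?_
      exact not_lt.2 ((π.t_le (not_lt.1 hjk) hj.le).trans hs.1)

theorem measurable_rot (k : ℕ) (c : ℕ → ℝ × ℝ) : Measurable (rot k c) := by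
  refine measurable_pi_lambda _ fun i => ?_
  by_cases hi : i < k
  · simp only [rot, hi, if_true]
    exact (measurable_rotI.comp (f := fun ω : Omega => ((c i).1, (ω i).1))
      (by fun_prop)).prodMk (measurable_rotI.comp (f := fun ω : Omega => ((c i).2, (ω i).2))
      (by fun_prop))
  · simp only [rot, hi, if_false]
    fun_prop

theorem comp_rot_mem_Adm (h𝓖 : ∀ k c j, Measurable[𝓖 j, 𝓖 j] (rot k c)) {u : ℝ → Omega → E}
    (hu : u ∈ Adm 𝓖 E π) (k : ℕ) (c : ℕ → ℝ × ℝ) :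
    (fun s ω => u s (rot k c ω)) ∈ Adm 𝓖 E π := by
  exact ⟨hu.1.comp (measurable_fst.prodMk ((measurable_rot k c).comp measurable_snd)),
    fun j hj => (hu.2 j hj).comp (measurable_rot_Fsig k c j) (h𝓖 k c j)⟩

theorem Adm1.eq_of_agree [MeasurableSingletonClass E] {u : ℝ → Omega → E}
    (hu : u ∈ Adm Gsig E π) {j : ℕ} (hj : j < π.n) {s : ℝ}
    (hs : s ∈ Ico (π.t j) (π.t (j + 1))) {ω ω' : Omega} (h : ∀ i < j, ω i = ω' i)
    (h' : (ω j).1 = (ω' j).1) : u s ω = u s ω' := by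
  obtain ⟨Γ, w, h1, -, h3, h4, h5⟩ := hu.2 j hj
  obtain ⟨k, hk⟩ := mem_iUnion.1 (h3.symm ▸ mem_univ ω : ω ∈ ⋃ k, Γ k)
  rw [h5 k ω hk s hs, h5 k ω' ((mem_iff_of_measurableSet_Fsig (h1 k) h).1 hk) s hs]
  exact eq_of_measurable_comap (c := fun ω : Omega => (ω j).1) (h4 k s) h'

theorem Adm2.eq_of_agree [MeasurableSingletonClass E] {u : ℝ → Omega → E}
    (hu : u ∈ Adm Hsig E π) {j : ℕ} (hj : j < π.n) {s : ℝ}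
    (hs : s ∈ Ico (π.t j) (π.t (j + 1))) {ω ω' : Omega} (h : ∀ i < j, ω i = ω' i)
    (h' : (ω j).2 = (ω' j).2) : u s ω = u s ω' := by
  obtain ⟨Γ, w, h1, -, h3, h4, h5⟩ := hu.2 j hj
  obtain ⟨k, hk⟩ := mem_iUnion.1 (h3.symm ▸ mem_univ ω : ω ∈ ⋃ k, Γ k)
  rw [h5 k ω hk s hs, h5 k ω' ((mem_iff_of_measurableSet_Fsig (h1 k) h).1 hk) s hs]
  exact eq_of_measurable_comap (c := fun ω : Omega => (ω j).2) (h4 k s) h'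

end Controls

/-! ### Strategies and the associated controls -/

section Strategies

variable {E E' : Type*} {T : ℝ} {π : Partition T} {P : Measure Omega}

/-- NAD strategies on `[t,T]` mapping the controls in `𝓐` to controls in `𝓑`. -/
def IsNAD (P : Measure Omega) (π : Partition T) (t : ℝ) (𝓐 : Set (ℝ → Omega → E))
    (𝓑 : Set (ℝ → Omega → E')) (α : (ℝ → Omega → E) → (ℝ → Omega → E')) : Prop :=
  (∀ v ∈ 𝓐, α v ∈ 𝓑) ∧
  ∀ τ : Omega → ℕ, IsStoppingIdx π τ → ∀ v v', v ∈ 𝓐 → v' ∈ 𝓐 →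
    aeStEq P t (fun ω => π.t (τ ω)) v v' → aeStEq P t (fun ω => π.t (τ ω + 1)) (α v) (α v')

theorem isNAD_const {t : ℝ} {𝓐 : Set (ℝ → Omega → E)} {𝓑 : Set (ℝ → Omega → E')}
    {u : ℝ → Omega → E'} (hu : u ∈ 𝓑) : IsNAD P π t 𝓐 𝓑 fun _ => u :=
  ⟨fun _ _ => hu, fun _ _ _ _ _ _ _ => ae_of_all _ fun _ _ _ => rfl⟩

theorem ae_time [SFinite P] {p : ℝ → Prop} (h : ∀ᵐ s, p s) :
    ∀ᵐ q ∂((volume : Measure ℝ).prod P), p q.1 :=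
  Measure.quasiMeasurePreserving_fst.ae h

theorem ae_sample [SFinite P] {p : Omega → Prop} (h : ∀ᵐ ω ∂P, p ω) :
    ∀ᵐ q ∂((volume : Measure ℝ).prod P), p q.2 :=
  Measure.quasiMeasurePreserving_snd.ae h

theorem ae_ae_swap [SFinite P] {p : ℝ → Omega → Prop}
    (h : ∀ᵐ q ∂((volume : Measure ℝ).prod P), p q.1 q.2) : ∀ᵐ ω ∂P, ∀ᵐ s, p s ω :=
  Measure.ae_ae_of_ae_prod
    ((Measure.measurePreserving_swap (μ := P)
      (ν := (volume : Measure ℝ))).quasiMeasurePreserving.ae h)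

theorem isStoppingIdx_const {j : ℕ} (hj : j < π.n) : IsStoppingIdx π fun _ => j := by
  refine ⟨fun _ => hj, fun i => ?_⟩
  by_cases h : j = i
  · simp only [h]
    exact @MeasurableSet.univ _ (Fsig i)
  · simp only [h]
    exact @MeasurableSet.empty _ (Fsig i)

theorem IsStoppingIdx.sup {τ : Omega → ℕ} (hτ : IsStoppingIdx π τ) {k : ℕ} (hk : k < π.n) :
    IsStoppingIdx π fun ω => max (τ ω) k := by
  refine ⟨fun ω => max_lt (hτ.1 ω) hk, fun j => ?_⟩
  have : {ω | max (τ ω) k = j} = ⋃ i, {ω | τ ω = i ∧ max i k = j} := by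
    ext ω; simp
  rw [this]
  refine @MeasurableSet.iUnion _ _ (Fsig j) _ _ fun i => ?_
  by_cases hi : max i k = j
  · simp only [hi, and_true]
    exact Fsig_mono (hi ▸ le_max_left i k) _ (hτ.2 i)
  · simp only [hi, and_false]
    exact @MeasurableSet.empty _ (Fsig j)

theorem isStoppingIdx_piecewise {A : Set Omega} {j k : ℕ} (hA : MeasurableSet[Fsig k] A)
    (hkj : k ≤ j) (hj : j < π.n) [DecidablePred (· ∈ A)] :
    IsStoppingIdx π fun ω => if ω ∈ A then j else k := by
  refine ⟨fun ω => by dsimp only; split_ifs <;> omega, fun i => ?_⟩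
  have : {ω | (if ω ∈ A then j else k) = i}
      = {ω | ω ∈ A ∧ j = i} ∪ {ω | ω ∈ Aᶜ ∧ k = i} := by
    ext ω
    by_cases h : ω ∈ A <;> simp [h]
  rw [this]
  refine @MeasurableSet.union _ (Fsig i) _ _ ?_ ?_
  · by_cases hi : j = i
    · simp only [hi, and_true]
      exact Fsig_mono (hi ▸ hkj) _ hA
    · simp only [hi, and_false]
      exact @MeasurableSet.empty _ (Fsig i)
  · by_cases hi : k = i
    · subst hi
      simp only [and_true]
      exact hA.compl
    · simp only [hi, and_false]
      exact @MeasurableSet.empty _ (Fsig i)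

theorem exists_fixed_point [SFinite P] {t : ℝ} (ht : 0 ≤ t) {𝓐 : Set (ℝ → Omega → E)}
    {𝓑 : Set (ℝ → Omega → E')} (h𝓐 : 𝓐.Nonempty) (h𝓑 : 𝓑.Nonempty)
    {α : (ℝ → Omega → E) → (ℝ → Omega → E')} {β : (ℝ → Omega → E') → (ℝ → Omega → E)}
    (hα : IsNAD P π t 𝓐 𝓑 α) (hβ : IsNAD P π t 𝓑 𝓐 β) :
    ∃ u ∈ 𝓑, ∃ v ∈ 𝓐, aeEqIcc P t T (α v) u ∧ aeEqIcc P t T (β u) v := by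
  obtain ⟨v0, hv0⟩ := h𝓐
  obtain ⟨u0, hu0⟩ := h𝓑
  let q : ℕ → (ℝ → Omega → E') × (ℝ → Omega → E) :=
    fun m => (fun p => (α p.2, β p.1))^[m] (u0, v0)
  have hq : ∀ m, q (m + 1) = (α (q m).2, β (q m).1) := fun m =>
    Function.iterate_succ_apply' _ _ _
  have hmem : ∀ m, (q m).1 ∈ 𝓑 ∧ (q m).2 ∈ 𝓐 := by
    intro m
    induction m with
    | zero => exact ⟨hu0, hv0⟩
    | succ m ih => rw [hq]; exact ⟨hα.1 _ ih.2, hβ.1 _ ih.1⟩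
  have key : ∀ j ≤ π.n, ∀ m ≥ j, aeStEq P t (fun _ => π.t j) (q m).1 (q (m + 1)).1 ∧
      aeStEq P t (fun _ => π.t j) (q m).2 (q (m + 1)).2 := by
    intro j
    induction j with
    | zero =>
      intro _ m _
      have h0 := ae_time (P := P) (Measure.ae_ne volume (0 : ℝ))
      constructor <;>
      · filter_upwards [h0] with p hp h1 h2
        rw [π.map_zero] at h2
        exact absurd (le_antisymm h2 (ht.trans h1)) hp
    | succ j ih =>
      intro hj m hm
      obtain ⟨m, rfl⟩ : ∃ m', m = m' + 1 := ⟨m - 1, by omega⟩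
      have h := ih (by omega) m (by omega)
      rw [hq (m + 1)]
      conv in q (m + 1) => rw [hq m]
      rw [hq m]
      have hmm := hmem m
      have hmm' := hmem (m + 1)
      rw [hq m] at h hmm'
      exact ⟨hα.2 _ (isStoppingIdx_const (by omega)) _ _ hmm.2 hmm'.2 h.2,
        hβ.2 _ (isStoppingIdx_const (by omega)) _ _ hmm.1 hmm'.1 h.1⟩
  obtain ⟨h1, h2⟩ := key π.n le_rfl π.n le_rfl
  rw [hq] at h1 h2
  refine ⟨_, (hmem π.n).1, _, (hmem π.n).2, ?_, ?_⟩
  · filter_upwards [h1] with p hp hpt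
    exact (hp hpt.1 (π.map_last.symm ▸ hpt.2)).symm
  · filter_upwards [h2] with p hp hpt
    exact (hp hpt.1 (π.map_last.symm ▸ hpt.2)).symm

/-- Couples of controls compatible with a couple of NAD strategies on an `𝓕_k`-measurable event
agree there after time `t_k`. -/
theorem fixed_point_unique_on [SFinite P] {k : ℕ} (hk : k < π.n) {A : Set Omega}
    (hA : MeasurableSet[Fsig k] A) {𝓐 : Set (ℝ → Omega → E)} {𝓑 : Set (ℝ → Omega → E')}
    {α : (ℝ → Omega → E) → (ℝ → Omega → E')} {β : (ℝ → Omega → E') → (ℝ → Omega → E)}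
    (hα : IsNAD P π (π.t k) 𝓐 𝓑 α) (hβ : IsNAD P π (π.t k) 𝓑 𝓐 β)
    {u u' : ℝ → Omega → E'} {v v' : ℝ → Omega → E} (hu : u ∈ 𝓑) (hu' : u' ∈ 𝓑) (hv : v ∈ 𝓐)
    (hv' : v' ∈ 𝓐)
    (h1 : ∀ᵐ p ∂((volume : Measure ℝ).prod P), p.2 ∈ A → p.1 ∈ Icc (π.t k) T →
      α v p.1 p.2 = u p.1 p.2 ∧ β u p.1 p.2 = v p.1 p.2)
    (h2 : ∀ᵐ p ∂((volume : Measure ℝ).prod P), p.2 ∈ A → p.1 ∈ Icc (π.t k) T →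
      α v' p.1 p.2 = u' p.1 p.2 ∧ β u' p.1 p.2 = v' p.1 p.2) :
    ∀ᵐ p ∂((volume : Measure ℝ).prod P), p.2 ∈ A → p.1 ∈ Icc (π.t k) T →
      u p.1 p.2 = u' p.1 p.2 ∧ v p.1 p.2 = v' p.1 p.2 := by
  classical
  have h0 := ae_time (P := P) (Measure.ae_ne volume (π.t k))
  have key : ∀ j, k ≤ j → j ≤ π.n → ∀ᵐ p ∂((volume : Measure ℝ).prod P), p.2 ∈ A →
      p.1 ∈ Icc (π.t k) (π.t j) → u p.1 p.2 = u' p.1 p.2 ∧ v p.1 p.2 = v' p.1 p.2 := by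
    intro j hkj
    induction j, hkj using Nat.le_induction with
    | base =>
      intro _
      filter_upwards [h0] with p hp _ hp'
      exact absurd (le_antisymm hp'.2 hp'.1) hp
    | succ j hkj ih =>
      intro hj
      have hτ := isStoppingIdx_piecewise (π := π) hA hkj (by omega)
      have ih' := ih (by omega)
      have e1 := hα.2 _ hτ v v' hv hv' (by
        filter_upwards [h0, ih'] with p hp hp' hp1 hp2
        by_cases hpA : p.2 ∈ A
        · simp only [hpA, if_true] at hp2
          exact (hp' hpA ⟨hp1, hp2⟩).2
        · simp only [hpA, if_false] at hp2
          exact absurd (le_antisymm hp2 hp1) hp)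
      have e2 := hβ.2 _ hτ u u' hu hu' (by
        filter_upwards [h0, ih'] with p hp hp' hp1 hp2
        by_cases hpA : p.2 ∈ A
        · simp only [hpA, if_true] at hp2
          exact (hp' hpA ⟨hp1, hp2⟩).1
        · simp only [hpA, if_false] at hp2
          exact absurd (le_antisymm hp2 hp1) hp)
      filter_upwards [h1, h2, e1, e2] with p a1 a2 a3 a4 hpA hp
      simp only [hpA, if_true] at a3 a4
      have hp' : p.1 ∈ Icc (π.t k) T := ⟨hp.1, hp.2.trans (π.t_mem hj).2⟩
      obtain ⟨b1, b2⟩ := a1 hpA hp'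
      obtain ⟨b3, b4⟩ := a2 hpA hp'
      rw [← b1, ← b2, ← b3, ← b4]
      exact ⟨a3 hp.1 hp.2, a4 hp.1 hp.2⟩
  have := key π.n hk.le le_rfl
  rwa [π.map_last] at this

end Strategies

/-! ### Essential suprema and infima -/

section EssSup

variable {P : Measure Omega} {ι : Type*} {ξ ξ' : ι → Omega → ℝ} {S S' : Omega → ℝ}

theorem IsEssSupFam.ae_eq (h : IsEssSupFam P ξ S) (h' : IsEssSupFam P ξ S') : S =ᵐ[P] S' :=
  (h.2 _ h'.1).antisymm (h'.2 _ h.1)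

theorem IsEssSupFam.congr (h : IsEssSupFam P ξ S) (he : ∀ i, ξ i =ᵐ[P] ξ' i) :
    IsEssSupFam P ξ' S :=
  ⟨fun i => (he i).symm.le.trans (h.1 i), fun W hW => h.2 W fun i => (he i).le.trans (hW i)⟩

theorem isEssInfFam_iff_neg :
    IsEssInfFam P ξ S ↔ IsEssSupFam P (fun i ω => -ξ i ω) fun ω => -S ω := by
  constructor
  · rintro ⟨h1, h2⟩
    refine ⟨fun i => (h1 i).mono fun ω h => neg_le_neg h, fun W hW => ?_⟩
    exact (h2 (fun ω => -W ω) fun i => (hW i).mono fun ω h => neg_le.1 h).mono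
      fun ω h => neg_le.1 h
  · rintro ⟨h1, h2⟩
    refine ⟨fun i => (h1 i).mono fun ω h => neg_le_neg_iff.1 h, fun W hW => ?_⟩
    exact (h2 (fun ω => -W ω) fun i => (hW i).mono fun ω h => neg_le_neg h).mono
      fun ω h => neg_le_neg_iff.1 h

/-- `ξ` has a version which is `𝓕_k`-measurable and bounded by `C`. -/
def HasBddVersion (P : Measure Omega) (k : ℕ) (C : ℝ) (ξ : Omega → ℝ) : Prop :=
  ∃ g, Measurable[Fsig k] g ∧ (∀ ω, |g ω| ≤ C) ∧ ξ =ᵐ[P] g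

variable [IsProbabilityMeasure P] {k : ℕ} {C : ℝ}

theorem HasBddVersion.integrable {ζ : Omega → ℝ} (h : HasBddVersion P k C ζ) : Integrable ζ P := by
  obtain ⟨g, h1, h2, h3⟩ := h
  exact (Integrable.of_bound (C := C) (h1.mono (Fsig_le k) le_rfl).aestronglyMeasurable
    (ae_of_all _ h2)).congr h3.symm

theorem HasBddVersion.neg {ζ : Omega → ℝ} (h : HasBddVersion P k C ζ) :
    HasBddVersion P k C fun ω => -ζ ω := by
  obtain ⟨g, h1, h2, h3⟩ := h
  exact ⟨fun ω => -g ω, h1.neg, fun ω => by rw [abs_neg]; exact h2 ω, h3.fun_comp Neg.neg⟩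

theorem exists_seq_isEssSupFam_of_measurable [Nonempty ι] {g : ι → Omega → ℝ}
    (hg : ∀ i, Measurable (g i)) (hC : ∀ i ω, |g i ω| ≤ C) :
    ∃ b : ℕ → ι, IsEssSupFam P g fun ω => ⨆ n, g (b n) ω := by
  have hbdd : ∀ (b : ℕ → ι) ω, BddAbove (range fun n => g (b n) ω) := fun b ω =>
    ⟨C, by rintro _ ⟨n, rfl⟩; exact (abs_le.1 (hC _ _)).2⟩
  set G : (ℕ → ι) → Omega → ℝ := fun b ω => ⨆ n, g (b n) ω with hG
  have hGm : ∀ b, Measurable (G b) := fun b => Measurable.iSup fun n => hg _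
  have hGC : ∀ b ω, |G b ω| ≤ C := fun b ω => abs_le.2
    ⟨(abs_le.1 (hC (b 0) ω)).1.trans (le_ciSup (hbdd b ω) 0),
      ciSup_le fun n => (abs_le.1 (hC _ _)).2⟩
  have hGi : ∀ b, Integrable (G b) P := fun b =>
    Integrable.of_bound (C := C) (hGm b).aestronglyMeasurable (ae_of_all _ (hGC b))
  set s : ℝ := ⨆ b, ∫ ω, G b ω ∂P with hs
  have hsb : BddAbove (range fun b => ∫ ω, G b ω ∂P) := by
    refine ⟨C, ?_⟩
    rintro _ ⟨b, rfl⟩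
    calc ∫ ω, G b ω ∂P ≤ ∫ _, C ∂P :=
          integral_mono (hGi b) (integrable_const _) fun ω => (abs_le.1 (hGC b ω)).2
      _ = C := by simp
  obtain ⟨x, hx, hx'⟩ : ∃ x : ℕ → ℝ, (∀ k, x k < s) ∧ Tendsto x atTop (𝓝 s) :=
    ⟨fun k => s - 1 / ((k : ℝ) + 1), fun k => by
      have : 0 < 1 / ((k : ℝ) + 1) := by positivity
      linarith, by
        simpa using (tendsto_const_nhds (x := s)).sub
          (tendsto_one_div_add_atTop_nhds_zero_nat (𝕜 := ℝ))⟩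
  have hex : ∀ k, ∃ b, x k < ∫ ω, G b ω ∂P := fun k => exists_lt_of_lt_ciSup (hx k)
  choose a ha using hex
  set b : ℕ → ι := fun n => a n.unpair.1 n.unpair.2 with hb
  have hab : ∀ k ω, G (a k) ω ≤ G b ω := fun k ω => ciSup_le fun n => by
    have := le_ciSup (hbdd b ω) (Nat.pair k n)
    simpa [hb] using this
  have hsup : s ≤ ∫ ω, G b ω ∂P := by
    refine le_of_tendsto hx' (Eventually.of_forall fun k => (ha k).le.trans ?_)
    exact integral_mono (hGi _) (hGi _) (hab k)
  refine ⟨b, fun i => ?_, fun W hW => ?_⟩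
  · let c : ℕ → ι := fun n => Nat.casesOn n i b
    have hbc : ∀ ω, G b ω ≤ G c ω := fun ω => ciSup_le fun n => le_ciSup (hbdd c ω) (n + 1)
    have hle : ∫ ω, G c ω ∂P ≤ ∫ ω, G b ω ∂P := (le_ciSup hsb c).trans hsup
    have heq : G b =ᵐ[P] G c := by
      rw [← integral_eq_iff_of_ae_le (hGi b) (hGi c) (ae_of_all _ hbc)]
      exact le_antisymm (integral_mono (hGi b) (hGi c) hbc) hle
    filter_upwards [heq] with ω hω
    exact (le_ciSup (hbdd c ω) 0).trans hω.ge
  · have : ∀ᵐ ω ∂P, ∀ n, g (b n) ω ≤ W ω := ae_all_iff.2 fun n => hW (b n)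
    filter_upwards [this] with ω hω
    exact ciSup_le hω

theorem exists_isEssSupFam [Nonempty ι]
       (hξ : ∀ i, HasBddVersion P k C (ξ i)) :
    ∃ (b : ℕ → ι) (S : Omega → ℝ), IsEssSupFam P ξ S ∧ Measurable[Fsig k] S ∧ (∀ ω, |S ω| ≤ C) ∧
      (S =ᵐ[P] fun ω => ⨆ n, ξ (b n) ω) ∧ ∀ᵐ ω ∂P, BddAbove (range fun n => ξ (b n) ω) := by
  choose g h1 h2 h3 using hξ
  obtain ⟨b, hb⟩ := exists_seq_isEssSupFam_of_measurable (P := P)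
    (fun i => (h1 i).mono (Fsig_le k) le_rfl) h2
  have hall : ∀ᵐ ω ∂P, ∀ n, ξ (b n) ω = g (b n) ω := ae_all_iff.2 fun n => h3 (b n)
  have hbdd : ∀ ω, BddAbove (range fun n => g (b n) ω) := fun ω =>
    ⟨C, by rintro _ ⟨n, rfl⟩; exact (abs_le.1 (h2 _ _)).2⟩
  refine ⟨b, _, hb.congr fun i => (h3 i).symm, Measurable.iSup fun n => h1 (b n), fun ω => abs_le.2 ⟨(abs_le.1 (h2 (b 0) ω)).1.trans
      (le_ciSup (hbdd ω) 0), ciSup_le fun n => (abs_le.1 (h2 _ _)).2⟩, ?_, ?_⟩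
  · filter_upwards [hall] with ω hω
    simp only [hω]
  · filter_upwards [hall] with ω hω
    simp only [hω]
    exact hbdd ω

theorem IsEssSupFam.hasBddVersion [Nonempty ι]
    (hξ : ∀ i, HasBddVersion P k C (ξ i)) (h : IsEssSupFam P ξ S) : HasBddVersion P k C S := by
  obtain ⟨b, S', h1, h2, h3, -⟩ := exists_isEssSupFam hξ
  exact ⟨S', h2, h3, h.ae_eq h1⟩

theorem IsEssSupFam.exists_seq_lt [Nonempty ι] (hξ : ∀ i, HasBddVersion P k C (ξ i))
    (h : IsEssSupFam P ξ S) {ε : ℝ} (hε : 0 < ε) :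
    ∃ b : ℕ → ι, ∀ᵐ ω ∂P, ∃ n, S ω - ε < ξ (b n) ω := by
  obtain ⟨b, S', h1, -, -, h4, h5⟩ := exists_isEssSupFam hξ
  refine ⟨b, ?_⟩
  filter_upwards [h.ae_eq h1, h4, h5] with ω e1 e2 e3
  refine exists_lt_of_lt_ciSup ?_
  rw [e1, e2]
  linarith

theorem exists_isEssInfFam [Nonempty ι]
    (hξ : ∀ i, HasBddVersion P k C (ξ i)) : ∃ S, IsEssInfFam P ξ S := by
  obtain ⟨-, S, h, -⟩ := exists_isEssSupFam fun i => (hξ i).neg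
  exact ⟨fun ω => -S ω, isEssInfFam_iff_neg.2 (by simpa using h)⟩

theorem IsEssInfFam.hasBddVersion [Nonempty ι]
    (hξ : ∀ i, HasBddVersion P k C (ξ i)) (h : IsEssInfFam P ξ S) : HasBddVersion P k C S := by
  simpa using ((isEssInfFam_iff_neg.1 h).hasBddVersion fun i => (hξ i).neg).neg

end EssSup

/-! ### Pay-offs and lower values -/

section LowerValue

/-- Bounded Lipschitz terminal pay-offs. -/
structure IsRegularPayoff {d : ℕ} (g : EuclideanSpace ℝ (Fin d) → ℝ) (B L : ℝ) : Prop where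
  bdd : ∀ x, |g x| ≤ B
  nonneg : 0 ≤ L
  lip : ∀ x y, |g x - g y| ≤ L * ‖x - y‖

theorem IsRegularPayoff.continuous {d : ℕ} {g : EuclideanSpace ℝ (Fin d) → ℝ} {B L : ℝ}
    (hg : IsRegularPayoff g B L) : Continuous g :=
  (LipschitzWith.of_dist_le_mul (K := ⟨L, hg.nonneg⟩) fun x y => by
    rw [Real.dist_eq, dist_eq_norm]; exact hg.lip x y).continuous

variable {d : ℕ} {U V : Type} [MetricSpace U] [CompactSpace U] [MetricSpace V] [CompactSpace V]
  [MeasurableSpace U] [BorelSpace U] [MeasurableSpace V] [BorelSpace V] [Nonempty U] [Nonempty V]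
  {T : ℝ} {f : ℝ → EuclideanSpace ℝ (Fin d) → U → V → EuclideanSpace ℝ (Fin d)}
  {g : EuclideanSpace ℝ (Fin d) → ℝ} {C K B L : ℝ}
  {P : Measure Omega} [IsProbabilityMeasure P] {π : Partition T}
  {α : (ℝ → Omega → V) → (ℝ → Omega → U)} {β : (ℝ → Omega → U) → (ℝ → Omega → V)}

theorem isFixPair_fixPair {t : ℝ} (ht : 0 ≤ t) (hα : IsNAD1 U V P π t α)
    (hβ : IsNAD2 U V P π t β) :
    IsFixPair P π t T α β (fixPair P π t T α β).1 (fixPair P π t T α β).2 := by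
  obtain ⟨u, hu, v, hv, h1, h2⟩ := exists_fixed_point ht (𝓐 := Adm Hsig V π) (𝓑 := Adm Gsig U π)
    ⟨_, const_mem_Adm (Classical.arbitrary V)⟩ ⟨_, const_mem_Adm (Classical.arbitrary U)⟩ hα hβ
  exact Classical.epsilon_spec (p := fun p : (ℝ → Omega → U) × (ℝ → Omega → V) =>
    IsFixPair P π t T α β p.1 p.2) ⟨(u, v), hu, hv, h1, h2⟩

theorem abs_payoff_le (hg : IsRegularPayoff g B L) {t : ℝ} {x : EuclideanSpace ℝ (Fin d)}
    (ω : Omega) : |payoff f g P π t x α β ω| ≤ B := hg.bdd _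

theorem measurable_payoff (hf : IsRegular T f C K) (hg : IsRegularPayoff g B L) {t : ℝ}
    (ht : t ∈ Icc 0 T) {x : EuclideanSpace ℝ (Fin d)} (hα : IsNAD1 U V P π t α)
    (hβ : IsNAD2 U V P π t β) : Measurable (payoff f g P π t x α β) := by
  obtain ⟨hu, hv, -⟩ := isFixPair_fixPair ht.1 hα hβ
  exact hg.continuous.measurable.comp ((measurable_sol hf ht.1 hu.1 hv.1 x).comp
    (f := fun ω : Omega => ((⟨T, ht.2, le_rfl⟩ : Icc t T), ω)) (by fun_prop))

theorem integrable_payoff (hf : IsRegular T f C K) (hg : IsRegularPayoff g B L) {t : ℝ}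
    (ht : t ∈ Icc 0 T) {x : EuclideanSpace ℝ (Fin d)} (hα : IsNAD1 U V P π t α)
    (hβ : IsNAD2 U V P π t β) : Integrable (payoff f g P π t x α β) P :=
  Integrable.of_bound (C := B) (measurable_payoff hf hg ht hα hβ).aestronglyMeasurable
    (ae_of_all _ (abs_payoff_le hg))

theorem hasBddVersion_condExp (hg : IsRegularPayoff g B L) {ξ : Omega → ℝ}
    (hξ : ∀ ω, |ξ ω| ≤ B) (k : ℕ) : HasBddVersion P k B (P[ξ | Fsig k]) := by
  have hB : 0 ≤ B := (abs_nonneg _).trans (hg.bdd 0)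
  have hm : Measurable[Fsig k] (P[ξ | Fsig k]) := stronglyMeasurable_condExp.measurable
  refine ⟨fun ω => max (-B) (min B ((P[ξ | Fsig k]) ω)), ?_, fun ω => ?_, ?_⟩
  · exact measurable_const.max (measurable_const.min hm)
  · exact abs_le.2 ⟨le_max_left _ _, max_le (by linarith) (min_le_left _ _)⟩
  · filter_upwards [ae_bdd_abs_condExp_of_ae_bdd_abs (m := Fsig k) (ae_of_all P hξ)] with ω hω
    have h := abs_le.1 hω
    rw [min_eq_right h.2, max_eq_right h.1]

instance {t : ℝ} : Nonempty {α // IsNAD1 U V P π t α} :=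
  ⟨⟨_, isNAD_const (𝓐 := Adm Hsig V π) (𝓑 := Adm Gsig U π)
    (const_mem_Adm (Classical.arbitrary U))⟩⟩

instance {t : ℝ} : Nonempty {β // IsNAD2 U V P π t β} :=
  ⟨⟨_, isNAD_const (𝓐 := Adm Gsig U π) (𝓑 := Adm Hsig V π)
    (const_mem_Adm (Classical.arbitrary V))⟩⟩

theorem isLowerVal_lowerVal (hg : IsRegularPayoff g B L) (t : ℝ)
    (x : EuclideanSpace ℝ (Fin d)) :
    IsLowerVal U V f g P π t x (lowerVal U V f g P π t x) := by
  have h1 : ∀ α : {α // IsNAD1 U V P π t α}, ∃ J, IsEssInfFam P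
      (fun β : {β // IsNAD2 U V P π t β} => P[payoff f g P π t x α.1 β.1 | Fsig (π.idx t)]) J :=
    fun α => exists_isEssInfFam fun β =>
      hasBddVersion_condExp hg (abs_payoff_le hg) (π.idx t)
  choose J hJ using h1
  obtain ⟨-, S, hS, -⟩ := exists_isEssSupFam (ξ := J) (k := π.idx t) (C := B) fun α =>
    (hJ α).hasBddVersion fun β => hasBddVersion_condExp hg (abs_payoff_le hg) (π.idx t)
  exact Classical.epsilon_spec (p := IsLowerVal U V f g P π t x) ⟨S, J, hJ, hS⟩

theorem hasBddVersion_lowerVal (hg : IsRegularPayoff g B L) (t : ℝ)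
    (x : EuclideanSpace ℝ (Fin d)) :
    HasBddVersion P (π.idx t) B (lowerVal U V f g P π t x) := by
  obtain ⟨J, hJ, hS⟩ := isLowerVal_lowerVal (U := U) (V := V) (f := f) (P := P) (π := π) hg t x
  exact hS.hasBddVersion fun α =>
    (hJ α).hasBddVersion fun β => hasBddVersion_condExp hg (abs_payoff_le hg) (π.idx t)

theorem le_lowerValD (hg : IsRegularPayoff g B L) {t : ℝ}
    {x : EuclideanSpace ℝ (Fin d)} (hα : IsNAD1 U V P π t α) {c : ℝ}
    (h : ∀ β, IsNAD2 U V P π t β →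
      ∀ᵐ ω ∂P, c ≤ (P[payoff f g P π t x α β | Fsig (π.idx t)]) ω) :
    c ≤ lowerValD U V f g P π t x := by
  obtain ⟨J, hJ, hS⟩ := isLowerVal_lowerVal (U := U) (V := V) (f := f) (P := P) (π := π) hg t x
  have h1 : (fun _ => c) ≤ᵐ[P] lowerVal U V f g P π t x :=
    ((hJ ⟨α, hα⟩).2 _ fun β => h β.1 β.2).trans (hS.1 ⟨α, hα⟩)
  calc c = ∫ _, c ∂P := by simp
    _ ≤ _ := integral_mono_ae (integrable_const _) (hasBddVersion_lowerVal hg t x).integrable h1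

theorem lowerValD_le (hg : IsRegularPayoff g B L) {t : ℝ}
    {x : EuclideanSpace ℝ (Fin d)} {c : ℝ}
    (h : ∀ α, IsNAD1 U V P π t α → ∃ β, IsNAD2 U V P π t β ∧
      ∀ᵐ ω ∂P, (P[payoff f g P π t x α β | Fsig (π.idx t)]) ω ≤ c) :
    lowerValD U V f g P π t x ≤ c := by
  obtain ⟨J, hJ, hS⟩ := isLowerVal_lowerVal (U := U) (V := V) (f := f) (P := P) (π := π) hg t x
  have h1 : lowerVal U V f g P π t x ≤ᵐ[P] fun _ => c := by
    refine hS.2 _ fun α => ?_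
    obtain ⟨β, hβ, hc⟩ := h α.1 α.2
    exact ((hJ α).1 ⟨β, hβ⟩).trans hc
  calc _ ≤ ∫ _, c ∂P :=
        integral_mono_ae (hasBddVersion_lowerVal hg t x).integrable (integrable_const _) h1
    _ = c := by simp

/-- Any couple of controls compatible with `(α,β)` on an `𝓕_k`-measurable event computes the
pay-off there. -/
theorem payoff_eq_on (hf : IsRegular T f C K) {k : ℕ} (hk : k < π.n)
    {A : Set Omega} (hA : MeasurableSet[Fsig k] A)
    (hα : IsNAD1 U V P π (π.t k) α) (hβ : IsNAD2 U V P π (π.t k) β) {u : ℝ → Omega → U}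
    {v : ℝ → Omega → V} (hu : u ∈ AdmControl1 U π) (hv : v ∈ AdmControl2 V π)
    (h : ∀ᵐ p ∂((volume : Measure ℝ).prod P), p.2 ∈ A → p.1 ∈ Icc (π.t k) T →
      α v p.1 p.2 = u p.1 p.2 ∧ β u p.1 p.2 = v p.1 p.2) (y : EuclideanSpace ℝ (Fin d)) :
    ∀ᵐ ω ∂P, ω ∈ A → payoff f g P π (π.t k) y α β ω
      = g (sol f T (π.t k) y (fun r => u r ω) (fun r => v r ω) T) := by
  have ht := π.t_mem hk.le
  obtain ⟨hu', hv', h1, h2⟩ := isFixPair_fixPair ht.1 hα hβ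
  have key := fixed_point_unique_on hk hA (𝓐 := Adm Hsig V π) (𝓑 := Adm Gsig U π) hα hβ
    hu' hu hv' hv (by filter_upwards [h1, h2] with p a1 a2 _ hp using ⟨a1 hp, a2 hp⟩) h
  filter_upwards [ae_ae_swap (p := fun s ω => ω ∈ A → s ∈ Icc (π.t k) T →
    (fixPair P π (π.t k) T α β).1 s ω = u s ω ∧ (fixPair P π (π.t k) T α β).2 s ω = v s ω) key]
    with ω hω hωA
  have m1 := Adm.section_measurable hu ω
  have m2 := Adm.section_measurable hv ω
  have m3 := Adm.section_measurable hu' ω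
  have m4 := Adm.section_measurable hv' ω
  refine congrArg g (IsSol.congr_controls hf ht.1 le_rfl (isSol_sol hf ht m3 m4 y)
    (isSol_sol hf ht m1 m2 y) m3 m4 m1 m2 ?_ ?_ T ⟨ht.2, le_rfl⟩)
  · filter_upwards [hω] with s hs hs' using (hs hωA hs').1
  · filter_upwards [hω] with s hs hs' using (hs hωA hs').2

end LowerValue

/-! ### Invariance of the lower value under rotations -/

section Rotation

/-- The measurable automorphism of the sample space given by a rotation. -/
def rotEquiv (k : ℕ) (c : ℕ → ℝ × ℝ) : Omega ≃ᵐ Omega where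
  toFun := rot k c
  invFun := rot k (-c)
  left_inv := rot_neg_rot k c
  right_inv := rot_rot_neg k c
  measurable_toFun := measurable_rot k c
  measurable_invFun := measurable_rot k (-c)

variable {P : Measure Omega} [IsProbabilityMeasure P] {T : ℝ} {π : Partition T}

theorem condExp_comp_rot (hP : IsProductMeasure P) (k : ℕ) (c : ℕ → ℝ × ℝ) {ξ : Omega → ℝ}
    (hξ : Integrable ξ P) :
    (P[fun ω => ξ (rot k c ω) | Fsig k]) =ᵐ[P] fun ω => (P[ξ | Fsig k]) (rot k c ω) := by
  have hmp := measurePreserving_rot hP k c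
  have hemb : MeasurableEmbedding (rot k c) := (rotEquiv k c).measurableEmbedding
  have hint : Integrable (fun ω => (P[ξ | Fsig k]) (rot k c ω)) P :=
    (hmp.integrable_comp_emb hemb).2 integrable_condExp
  refine (ae_eq_condExp_of_forall_setIntegral_eq (Fsig_le k)
    ((hmp.integrable_comp_emb hemb).2 hξ) (fun s _ _ => hint.integrableOn) (fun s hs _ => ?_)
    ?_).symm
  · have hs' : s = rot k c ⁻¹' (rot k (-c) ⁻¹' s) := by
      ext ω
      simp only [mem_preimage, rot_neg_rot]
    rw [hs', hmp.setIntegral_preimage_emb hemb]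
    refine Eq.trans ?_ (hmp.setIntegral_preimage_emb hemb ξ _).symm
    exact setIntegral_condExp (Fsig_le k) hξ (measurable_rot_Fsig k (-c) k hs)
  · exact (stronglyMeasurable_condExp.measurable.comp
      (measurable_rot_Fsig k c k)).stronglyMeasurable.aestronglyMeasurable

variable {E E' : Type*} [MeasurableSpace E] [MeasurableSpace E']
  {𝓖 𝓗 : ℕ → MeasurableSpace Omega}

/-- Conjugation of a strategy by a rotation. -/
def conjRot (k : ℕ) (c : ℕ → ℝ × ℝ) (α : (ℝ → Omega → E) → (ℝ → Omega → E')) :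
    (ℝ → Omega → E) → (ℝ → Omega → E') :=
  fun v s ω => α (fun s ω => v s (rot k (-c) ω)) s (rot k c ω)

theorem conjRot_conjRot_neg (k : ℕ) (c : ℕ → ℝ × ℝ)
    (α : (ℝ → Omega → E) → (ℝ → Omega → E')) : conjRot k c (conjRot k (-c) α) = α := by
  funext v s ω
  simp [conjRot, rot_neg_rot]

theorem ae_comp_rot (hP : IsProductMeasure P) (k : ℕ) (c : ℕ → ℝ × ℝ) {p : ℝ → Omega → Prop}
    (h : ∀ᵐ q ∂((volume : Measure ℝ).prod P), p q.1 q.2) :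
    ∀ᵐ q ∂((volume : Measure ℝ).prod P), p q.1 (rot k c q.2) :=
  ((MeasurePreserving.id volume).prod
    (measurePreserving_rot hP k c)).quasiMeasurePreserving.ae h

theorem isNAD_conjRot (hP : IsProductMeasure P) (h𝓖 : ∀ k c j, Measurable[𝓖 j, 𝓖 j] (rot k c))
    (h𝓗 : ∀ k c j, Measurable[𝓗 j, 𝓗 j] (rot k c)) {t : ℝ}
    {α : (ℝ → Omega → E) → (ℝ → Omega → E')} (hα : IsNAD P π t (Adm 𝓖 E π) (Adm 𝓗 E' π) α)
    (k : ℕ) (c : ℕ → ℝ × ℝ) : IsNAD P π t (Adm 𝓖 E π) (Adm 𝓗 E' π) (conjRot k c α) := by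
  refine ⟨fun v hv => comp_rot_mem_Adm h𝓗 (hα.1 _ (comp_rot_mem_Adm h𝓖 hv k (-c))) k c,
    fun τ hτ v v' hv hv' h => ?_⟩
  have hτ' : IsStoppingIdx π fun ω => τ (rot k (-c) ω) :=
    ⟨fun ω => hτ.1 _, fun j => measurable_rot_Fsig k (-c) j (hτ.2 j)⟩
  have h1 := hα.2 _ hτ' _ _ (comp_rot_mem_Adm h𝓖 hv k (-c)) (comp_rot_mem_Adm h𝓖 hv' k (-c))
    (ae_comp_rot hP k (-c) (p := fun s ω => t ≤ s → s ≤ π.t (τ ω) → v s ω = v' s ω) h)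
  have h2 := ae_comp_rot hP k c (p := fun s ω => t ≤ s → s ≤ π.t (τ (rot k (-c) ω) + 1) →
    α (fun s ω => v s (rot k (-c) ω)) s ω = α (fun s ω => v' s (rot k (-c) ω)) s ω) h1
  filter_upwards [h2] with p hp a1 a2
  rw [rot_neg_rot] at hp
  exact hp a1 a2

variable {d : ℕ} {U V : Type} [MetricSpace U] [CompactSpace U] [MetricSpace V] [CompactSpace V]
  [MeasurableSpace U] [BorelSpace U] [MeasurableSpace V] [BorelSpace V] [Nonempty U] [Nonempty V]
  {f : ℝ → EuclideanSpace ℝ (Fin d) → U → V → EuclideanSpace ℝ (Fin d)}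
  {g : EuclideanSpace ℝ (Fin d) → ℝ} {C K B L : ℝ}
  {α : (ℝ → Omega → V) → (ℝ → Omega → U)} {β : (ℝ → Omega → U) → (ℝ → Omega → V)}

theorem payoff_conjRot (hP : IsProductMeasure P) (hf : IsRegular T f C K) {k : ℕ} (hk : k < π.n)
    (hα : IsNAD1 U V P π (π.t k) α) (hβ : IsNAD2 U V P π (π.t k) β)
    (y : EuclideanSpace ℝ (Fin d)) (c : ℕ → ℝ × ℝ) :
    payoff f g P π (π.t k) y (conjRot k c α) (conjRot k c β)
      =ᵐ[P] fun ω => payoff f g P π (π.t k) y α β (rot k c ω) := by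
  obtain ⟨hu, hv, h1, h2⟩ := isFixPair_fixPair (π.t_mem hk.le).1 hα hβ
  have key := payoff_eq_on (g := g) hf hk (A := univ) MeasurableSet.univ
    (isNAD_conjRot hP measurable_rot_Hsig measurable_rot_Gsig hα k c)
    (isNAD_conjRot hP measurable_rot_Gsig measurable_rot_Hsig hβ k c)
    (comp_rot_mem_Adm measurable_rot_Gsig hu k c) (comp_rot_mem_Adm measurable_rot_Hsig hv k c)
    ?_ y
  · filter_upwards [key] with ω hω using hω trivial
  · filter_upwards [ae_comp_rot hP k c (p := fun s ω => s ∈ Icc (π.t k) T → _ = _) h1,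
      ae_comp_rot hP k c (p := fun s ω => s ∈ Icc (π.t k) T → _ = _) h2] with p a1 a2 _ hp
    simp only [conjRot, rot_rot_neg]
    exact ⟨a1 hp, a2 hp⟩

/-- At a partition time, the deterministic lower value is almost surely below the random one. -/
theorem lowerValD_le_lowerVal (hP : IsProductMeasure P) (hf : IsRegular T f C K)
    (hg : IsRegularPayoff g B L) {k : ℕ} (hk : k < π.n) (y : EuclideanSpace ℝ (Fin d)) :
    ∀ᵐ ω ∂P, lowerValD U V f g P π (π.t k) y ≤ lowerVal U V f g P π (π.t k) y ω := by
  have ht := π.t_mem hk.le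
  obtain ⟨J, hJ, hS⟩ :=
    isLowerVal_lowerVal (U := U) (V := V) (f := f) (P := P) (π := π) hg (π.t k) y
  obtain ⟨S, hS1, hS2, hS3⟩ :=
    hasBddVersion_lowerVal (U := U) (V := V) (f := f) (P := P) (π := π) hg (π.t k) y
  rw [π.idx_t hk] at hJ hS1
  have hJrot : ∀ (α : {α // IsNAD1 U V P π (π.t k) α}) c,
      ∀ᵐ ω ∂P, J α (rot k c ω) ≤ lowerVal U V f g P π (π.t k) y ω := by
    intro α c
    let α' : {α // IsNAD1 U V P π (π.t k) α} :=
      ⟨_, isNAD_conjRot hP measurable_rot_Hsig measurable_rot_Gsig α.2 k c⟩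
    have h1 : (fun ω => J α (rot k c ω)) ≤ᵐ[P] J α' := by
      refine (hJ α').2 _ fun β => ?_
      have hβ : IsNAD2 U V P π (π.t k) (conjRot k (-c) β.1) :=
        isNAD_conjRot hP measurable_rot_Gsig measurable_rot_Hsig β.2 k (-c)
      have e1 := payoff_conjRot (g := g) hP hf hk α.2 hβ y c
      rw [conjRot_conjRot_neg] at e1
      have e2 := condExp_comp_rot hP k c (integrable_payoff (x := y) hf hg ht α.2 hβ)
      have e3 := (measurePreserving_rot hP k c).quasiMeasurePreserving.ae ((hJ α).1 ⟨_, hβ⟩)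
      filter_upwards [condExp_congr_ae (m := Fsig k) e1, e2, e3] with ω a1 a2 a3
      rw [a1, a2]
      exact a3
    exact h1.trans (hS.1 α')
  have hrot : ∀ c, ∀ᵐ ω ∂P, S (rot k c ω) ≤ S ω := by
    intro c
    have h1 : lowerVal U V f g P π (π.t k) y ≤ᵐ[P]
        fun ω => lowerVal U V f g P π (π.t k) y (rot k (-c) ω) := by
      refine hS.2 _ fun α => ?_
      have := (measurePreserving_rot hP k (-c)).quasiMeasurePreserving.ae (hJrot α c)
      filter_upwards [this] with ω hω
      rwa [rot_rot_neg] at hω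
    have h2 := (measurePreserving_rot hP k c).quasiMeasurePreserving.ae h1
    have h3 := (measurePreserving_rot hP k c).quasiMeasurePreserving.ae hS3
    filter_upwards [h2, h3, hS3] with ω a1 a2 a3
    rw [rot_neg_rot] at a1
    rwa [← a2, ← a3]
  have h := integral_le_of_comp_rot_le hP hS1 hS2 hrot
  filter_upwards [h, hS3] with ω a1 a2
  rw [a2, lowerValD, integral_congr_ae hS3]
  exact a1

/-- Countably many strategies, selected in an `𝓕_k`-measurable way, are nearly optimal. -/
theorem exists_nearly_optimal (hP : IsProductMeasure P) (hf : IsRegular T f C K)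
    (hg : IsRegularPayoff g B L) {k : ℕ} (hk : k < π.n) (y : EuclideanSpace ℝ (Fin d)) {ε : ℝ}
    (hε : 0 < ε) :
    ∃ (a : ℕ → (ℝ → Omega → V) → (ℝ → Omega → U)) (N : Omega → ℕ),
      (∀ l, IsNAD1 U V P π (π.t k) (a l)) ∧ Measurable[Fsig k] N ∧
      ∀ l β, IsNAD2 U V P π (π.t k) β → ∀ᵐ ω ∂P, N ω = l →
        lowerValD U V f g P π (π.t k) y - ε
          ≤ (P[payoff f g P π (π.t k) y (a l) β | Fsig k]) ω := by
  classical
  obtain ⟨J, hJ, hS⟩ :=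
    isLowerVal_lowerVal (U := U) (V := V) (f := f) (P := P) (π := π) hg (π.t k) y
  rw [π.idx_t hk] at hJ
  have hJb : ∀ α, HasBddVersion P k B (J α) := fun α =>
    (hJ α).hasBddVersion fun β => hasBddVersion_condExp hg (abs_payoff_le hg) k
  obtain ⟨b, hb⟩ := hS.exists_seq_lt hJb hε
  choose G hG1 hG2 hG3 using hJb
  set r := lowerValD U V f g P π (π.t k) y - ε with hr
  let p : Omega → ℕ → Prop := fun ω n => r < G (b n) ω ∨ ∀ m, ¬ r < G (b m) ω
  have hp : ∀ ω, ∃ n, p ω n := fun ω => by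
    by_cases h : ∃ n, r < G (b n) ω
    · exact h.imp fun n hn => Or.inl hn
    · exact ⟨0, Or.inr (not_exists.1 h)⟩
  have hset : ∀ n, MeasurableSet[Fsig k] {ω | r < G (b n) ω} := fun n =>
    hG1 (b n) measurableSet_Ioi
  have hpm : ∀ n, MeasurableSet[Fsig k] {ω | p ω n} := fun n => by
    have : {ω | p ω n} = {ω | r < G (b n) ω} ∪ ⋂ m, {ω | r < G (b m) ω}ᶜ := by
      ext ω; simp [p]
    rw [this]
    exact @MeasurableSet.union _ (Fsig k) _ _ (hset n)
      (@MeasurableSet.iInter _ _ (Fsig k) _ _ fun m => (hset m).compl)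
  refine ⟨fun l => (b l).1, fun ω => Nat.find (hp ω), fun l => (b l).2,
    @measurable_find _ (Fsig k) _ _ hp hpm, fun l β hβ => ?_⟩
  have hall : ∀ᵐ ω ∂P, ∀ n, J (b n) ω = G (b n) ω := ae_all_iff.2 fun n => hG3 (b n)
  filter_upwards [hall, hb, (hJ (b l)).1 ⟨β, hβ⟩, lowerValD_le_lowerVal hP hf hg hk y]
    with ω a1 ⟨n, a2⟩ a3 a4 hl
  have hn : r < G (b n) ω := by rw [← a1, hr]; linarith
  rcases hl ▸ Nat.find_spec (hp ω) with h | h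
  · rw [← a1] at h
    exact h.le.trans a3
  · exact absurd hn (h n)

end Rotation

/-! ### Nearly optimal strategies after a partition time -/

section Concatenation

variable {P : Measure Omega} [IsProbabilityMeasure P] {T : ℝ} {π : Partition T}

theorem condExp_le_on {k : ℕ} {ξ η : Omega → ℝ} (hξ : Integrable ξ P) (hη : Integrable η P)
    {A : Set Omega} (hA : MeasurableSet[Fsig k] A) {c : ℝ}
    (h : ∀ᵐ ω ∂P, ω ∈ A → ξ ω ≤ η ω + c) :
    ∀ᵐ ω ∂P, ω ∈ A → (P[ξ | Fsig k]) ω ≤ (P[η | Fsig k]) ω + c := by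
  have hη' : Integrable (η + fun _ => c) P := hη.add (integrable_const c)
  have h1 : A.indicator ξ ≤ᵐ[P] A.indicator (η + fun _ => c) := by
    filter_upwards [h] with ω hω
    by_cases hωA : ω ∈ A
    · simpa [hωA] using hω hωA
    · simp [hωA]
  have h2 := condExp_mono (m := Fsig k) (hξ.indicator (Fsig_le k A hA))
    (hη'.indicator (Fsig_le k A hA)) h1
  filter_upwards [h2, condExp_indicator hξ hA, condExp_indicator hη' hA,
    condExp_add hη (integrable_const c) (Fsig k)] with ω a1 a2 a3 a4 hωA
  rw [a2, a3, indicator_of_mem hωA, indicator_of_mem hωA, a4] at a1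
  simpa [condExp_const (Fsig_le k)] using a1

/-- On each interval of the partition, the feedback `ψ` of the fresh randomisation of Player 1. -/
def randomControl {U : Type*} (π : Partition T) (ψ : I → U) (s : ℝ) (ω : Omega) : U :=
  ψ (ω (π.idx s)).1

theorem randomControl_mem_Adm {U : Type*} [MeasurableSpace U] {ψ : I → U} (hψ : Measurable ψ) :
    randomControl π ψ ∈ Adm Gsig U π := by
  refine ⟨?_, fun j hj => ?_⟩
  · have h1 : Measurable fun p : ℕ × Omega => ψ (p.2 p.1).1 :=
      measurable_from_prod_countable_right fun j => by
        exact hψ.comp (measurable_fst.comp (measurable_pi_apply j))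
    exact h1.comp ((π.measurable_idx.comp measurable_fst).prodMk measurable_snd)
  · refine (IsPasting.of_measurable (u := fun _ ω => ψ (ω j).1) fun s => ?_).congr
      fun s hs ω => by rw [randomControl, π.idx_eq hj hs]
    exact hψ.comp (comap_measurable _)

theorem isNAD_concat {E E' : Type*} {t0 : ℝ} {k : ℕ} (h0 : t0 ≤ π.t k)
    {𝓐 : Set (ℝ → Omega → E)} {𝓑 : Set (ℝ → Omega → E')}
    {β : (ℝ → Omega → E) → (ℝ → Omega → E')} (hβ : IsNAD P π t0 𝓐 𝓑 β) {u : ℝ → Omega → E}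
    (hcat : ∀ w ∈ 𝓐, (fun s ω => if s < π.t k then u s ω else w s ω) ∈ 𝓐) :
    IsNAD P π (π.t k) 𝓐 𝓑 fun w => β fun s ω => if s < π.t k then u s ω else w s ω := by
  refine ⟨fun w hw => hβ.1 _ (hcat w hw), fun τ hτ w w' hw hw' h => ?_⟩
  have h1 := hβ.2 τ hτ _ _ (hcat w hw) (hcat w' hw') (by
    filter_upwards [h] with p hp _ a2
    split_ifs with hs
    exacts [rfl, hp (not_lt.1 hs) a2])
  filter_upwards [h1] with p hp a1 a2 using hp (h0.trans a1) a2

variable {d : ℕ} {U V : Type} [MetricSpace U] [CompactSpace U] [MetricSpace V] [CompactSpace V]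
  [MeasurableSpace U] [BorelSpace U] [MeasurableSpace V] [BorelSpace V] [Nonempty U] [Nonempty V]
  {f : ℝ → EuclideanSpace ℝ (Fin d) → U → V → EuclideanSpace ℝ (Fin d)}
  {g : EuclideanSpace ℝ (Fin d) → ℝ} {C K B L : ℝ}

theorem measurable_Fsig_sol (hf : IsRegular T f C K) {t0 : ℝ} (ht0 : 0 ≤ t0) {k : ℕ}
    (hk : k < π.n) (h0 : t0 ≤ π.t k) {u : ℝ → Omega → U} (hu : u ∈ AdmControl1 U π)
    {v : ℝ → Omega → V} (hv : v ∈ AdmControl2 V π) (x : EuclideanSpace ℝ (Fin d)) :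
    Measurable[Fsig k] fun ω => sol f T t0 x (fun r => u r ω) (fun r => v r ω) (π.t k) := by
  have hkT := (π.t_mem hk.le).2
  refine measurable_Fsig_of_forall_eq ((measurable_sol hf ht0 hu.1 hv.1 x).comp
    (f := fun ω : Omega => ((⟨π.t k, h0, hkT⟩ : Icc t0 T), ω)) (by fun_prop))
    fun ω ω' h => ?_
  have ht : t0 ∈ Icc 0 T := ⟨ht0, h0.trans hkT⟩
  have m1 := Adm.section_measurable hu ω
  have m2 := Adm.section_measurable hv ω
  have m3 := Adm.section_measurable hu ω'
  have m4 := Adm.section_measurable hv ω'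
  have hidx : ∀ {s}, s ∈ Icc t0 (π.t k) → s ≠ π.t k →
      s ∈ Ico (π.t (π.idx s)) (π.t (π.idx s + 1)) ∧ π.idx s < k := by
    intro s hs hne
    have hs0 : 0 ≤ s := ht0.trans hs.1
    have hlt : s < π.t k := lt_of_le_of_ne hs.2 hne
    refine ⟨⟨π.t_idx_le hs0, π.lt_t_idx_succ (hlt.trans_le hkT)⟩, ?_⟩
    by_contra! hle
    exact absurd ((π.t_le hle (π.idx_lt s).le).trans (π.t_idx_le hs0)) hlt.not_ge
  refine IsSol.congr_controls hf ht0 hkT (isSol_sol hf ht m1 m2 x) (isSol_sol hf ht m3 m4 x)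
    m1 m2 m3 m4 ?_ ?_ _ ⟨h0, le_rfl⟩
  · filter_upwards [Measure.ae_ne volume (π.t k)] with s hne hs
    obtain ⟨a1, a2⟩ := hidx hs hne
    exact Adm1.eq_of_agree hu (π.idx_lt s) a1 (fun i hi => h i (hi.trans a2)) (by rw [h _ a2])
  · filter_upwards [Measure.ae_ne volume (π.t k)] with s hne hs
    obtain ⟨a1, a2⟩ := hidx hs hne
    exact Adm2.eq_of_agree hv (π.idx_lt s) a1 (fun i hi => h i (hi.trans a2)) (by rw [h _ a2])

/-- A strategy which plays a given random control until `t_k` and then switches to a nearly optimal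
continuation. -/
theorem exists_strategy_concat (hP : IsProductMeasure P) (hf : IsRegular T f C K)
    (hg : IsRegularPayoff g B L) {t0 : ℝ} (ht0 : 0 ≤ t0) {k : ℕ} (hk : k < π.n)
    (h0 : t0 ≤ π.t k) (x : EuclideanSpace ℝ (Fin d)) {u0 : ℝ → Omega → U}
    (hu0 : u0 ∈ AdmControl1 U π) {ε ε' : ℝ} (hε : 0 < ε) (hε' : 0 < ε') :
    ∃ α : (ℝ → Omega → V) → (ℝ → Omega → U), IsNAD1 U V P π t0 α ∧
      (∀ v, ∀ s < π.t k, ∀ ω, α v s ω = u0 s ω) ∧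
      ∀ β, IsNAD2 U V P π t0 β → ∀ᵐ ω ∂P, ∃ y,
        ‖y - solStrat f P π t0 T x α β (π.t k) ω‖ < ε' ∧
        lowerValD U V f g P π (π.t k) y - ε - L * (2 * ε' * Real.exp (2 * K * T))
          ≤ (P[payoff f g P π t0 x α β | Fsig k]) ω := by
  classical
  have hkT := π.t_mem hk.le
  have ht0T : t0 ∈ Icc 0 T := ⟨ht0, h0.trans hkT.2⟩
  set y : ℕ → EuclideanSpace ℝ (Fin d) := TopologicalSpace.denseSeq _ with hy
  have hyd : ∀ z, ∃ m, ‖y m - z‖ < ε' := fun z => by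
    obtain ⟨m, hm⟩ := (TopologicalSpace.denseRange_denseSeq
      (EuclideanSpace ℝ (Fin d))).exists_mem_open Metric.isOpen_ball
        ⟨z, Metric.mem_ball_self hε'⟩
    exact ⟨m, by rw [← dist_eq_norm]; exact hm⟩
  choose a Λ ha hΛ hopt using fun m =>
    exists_nearly_optimal (U := U) (V := V) hP hf hg hk (y m) hε
  let X : (ℝ → Omega → V) → Omega → EuclideanSpace ℝ (Fin d) := fun v ω =>
    sol f T t0 x (fun r => u0 r ω) (fun r => v r ω) (π.t k)
  let M : (ℝ → Omega → V) → Omega → ℕ := fun v ω => Nat.find (hyd (X v ω))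
  let N : (ℝ → Omega → V) → Omega → ℕ := fun v ω => Nat.pair (M v ω) (Λ (M v ω) ω)
  let α : (ℝ → Omega → V) → (ℝ → Omega → U) := fun v s ω =>
    if s < π.t k then u0 s ω else a (N v ω).unpair.1 (N v ω).unpair.2 v s ω
  have hN : ∀ v ∈ AdmControl2 V π, Measurable[Fsig k] (N v) := by
    intro v hv
    have hX : Measurable[Fsig k] (X v) := measurable_Fsig_sol hf ht0 hk h0 hu0 hv x
    have hM : Measurable[Fsig k] (M v) := by
      refine @measurable_find _ (Fsig k) _ _ (fun ω => hyd (X v ω)) fun m => ?_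
      have : MeasurableSet {z : EuclideanSpace ℝ (Fin d) | ‖y m - z‖ < ε'} :=
        measurableSet_lt (by fun_prop) measurable_const
      exact hX this
    refine @measurable_to_countable' _ _ _ _ (Fsig k) _ fun j => ?_
    have : N v ⁻¹' {j} = M v ⁻¹' {j.unpair.1} ∩ Λ j.unpair.1 ⁻¹' {j.unpair.2} := by
      ext ω
      simp only [mem_preimage, mem_singleton_iff, mem_inter_iff, N]
      constructor
      · rintro rfl
        simp
      · rintro ⟨h1, h2⟩
        rw [h1, h2, Nat.pair_unpair]
    rw [this]
    exact @MeasurableSet.inter _ (Fsig k) _ _ (hM (measurableSet_singleton _))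
      (hΛ _ (measurableSet_singleton _))
  have hαmem : ∀ v ∈ AdmControl2 V π, α v ∈ AdmControl1 U π := fun v hv =>
    concat_mem_Adm hu0 (w := fun j => a j.unpair.1 j.unpair.2 v)
      (fun j => (ha _ _).1 v hv) hk.le (hN v hv)
  have hα : IsNAD1 U V P π t0 α := by
    refine ⟨hαmem, fun τ hτ v v' hv hv' h => ?_⟩
    have hne := ae_time (P := P) (Measure.ae_ne volume (π.t k))
    have hNN : ∀ᵐ ω ∂P, k ≤ τ ω → N v ω = N v' ω := by
      filter_upwards [ae_ae_swap (p := fun s ω => t0 ≤ s → s ≤ π.t (τ ω) → v s ω = v' s ω) h]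
        with ω hω hkτ
      have hτk : π.t k ≤ π.t (τ ω) := π.t_le hkτ (hτ.1 ω).le
      have m1 := Adm.section_measurable hu0 ω
      have m2 := Adm.section_measurable hv ω
      have m3 := Adm.section_measurable hv' ω
      have hX : X v ω = X v' ω := IsSol.congr_controls hf ht0 hkT.2
        (isSol_sol hf ht0T m1 m2 x) (isSol_sol hf ht0T m1 m3 x) m1 m2 m1 m3
        (ae_of_all _ fun _ _ => rfl)
        (by filter_upwards [hω] with s hs hs' using hs hs'.1 (hs'.2.trans hτk)) _ ⟨h0, le_rfl⟩
      have hM : M v ω = M v' ω := by simp only [M, hX]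
      simp only [N, hM]
    have hall : ∀ᵐ p ∂((volume : Measure ℝ).prod P), ∀ j : ℕ, π.t k ≤ p.1 →
        p.1 ≤ π.t (max (τ p.2) k + 1) →
          a j.unpair.1 j.unpair.2 v p.1 p.2 = a j.unpair.1 j.unpair.2 v' p.1 p.2 := by
      refine ae_all_iff.2 fun j => (ha j.unpair.1 j.unpair.2).2 _ (hτ.sup hk) v v' hv hv' ?_
      filter_upwards [h, hne] with p hp hp' a1 a2
      rcases le_total k (τ p.2) with hle | hle
      · rw [max_eq_left hle] at a2
        exact hp (h0.trans a1) a2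
      · rw [max_eq_right hle] at a2
        exact absurd (le_antisymm a2 a1) hp'
    filter_upwards [hall, ae_sample hNN, hne] with p b1 b2 b3 a1 a2
    simp only [α]
    split_ifs with hs
    · rfl
    · have hs' : π.t k < p.1 := lt_of_le_of_ne (not_lt.1 hs) (Ne.symm b3)
      have hkτ : k ≤ τ p.2 := by
        by_contra! hlt
        exact absurd (a2.trans (π.t_le hlt hk.le)) hs'.not_ge
      rw [b2 hkτ]
      exact b1 _ hs'.le (by rwa [max_eq_left hkτ])
  refine ⟨α, hα, fun v s hs ω => if_pos hs, fun β hβ => ?_⟩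
  obtain ⟨hu, hv, h1, h2⟩ := isFixPair_fixPair ht0 hα hβ
  set u := (fixPair P π t0 T α β).1 with hu_def
  set v := (fixPair P π t0 T α β).2 with hv_def
  have hβ' : IsNAD2 U V P π (π.t k) fun w => β fun s ω => if s < π.t k then u s ω else w s ω :=
    isNAD_concat h0 hβ fun w hw => concat_mem_Adm (N := fun _ => 0) hu (fun _ => hw) hk.le
      measurable_const
  have hX : ∀ᵐ ω ∂P, X v ω = solStrat f P π t0 T x α β (π.t k) ω := by
    filter_upwards [ae_ae_swap (p := fun s ω => s ∈ Icc t0 T → α v s ω = u s ω) h1] with ω hω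
    have m1 := Adm.section_measurable hu ω
    have m2 := Adm.section_measurable hv ω
    have m3 := Adm.section_measurable hu0 ω
    refine IsSol.congr_controls hf ht0 hkT.2 (isSol_sol hf ht0T m3 m2 x)
      (isSol_sol hf ht0T m1 m2 x) m3 m2 m1 m2 ?_ (ae_of_all _ fun _ _ => rfl) _ ⟨h0, le_rfl⟩
    filter_upwards [hω, Measure.ae_ne volume (π.t k)] with s hs hne hs'
    rw [← hs ⟨hs'.1, hs'.2.trans hkT.2⟩]
    exact (if_pos (lt_of_le_of_ne hs'.2 hne)).symm
  have hj : ∀ j : ℕ, ∀ᵐ ω ∂P, N v ω = j →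
      (P[payoff f g P π (π.t k) (y j.unpair.1) (a j.unpair.1 j.unpair.2)
        (fun w => β fun s ω => if s < π.t k then u s ω else w s ω) | Fsig k]) ω
      ≤ (P[payoff f g P π t0 x α β | Fsig k]) ω + L * (2 * ε' * Real.exp (2 * K * T)) := by
    intro j
    have hA : MeasurableSet[Fsig k] (N v ⁻¹' {j}) := hN v hv (measurableSet_singleton j)
    refine condExp_le_on (integrable_payoff hf hg hkT (ha _ _) hβ')
      (integrable_payoff hf hg ht0T hα hβ) hA ?_
    have hpay := payoff_eq_on (g := g) hf hk hA (ha j.unpair.1 j.unpair.2) hβ' hu hv (by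
      filter_upwards [h1, h2] with p a1 a2 hp hp'
      have hp0 : p.1 ∈ Icc t0 T := ⟨h0.trans hp'.1, hp'.2⟩
      have hpN : N v p.2 = j := hp
      refine ⟨?_, ?_⟩
      · rw [← a1 hp0]
        simp only [α, if_neg (not_lt.2 hp'.1), hpN]
      · simp only [ite_self]
        exact a2 hp0) (y j.unpair.1)
    filter_upwards [hpay, hX] with ω a1 a2 hω
    rw [a1 hω]
    have m1 := Adm.section_measurable hu ω
    have m2 := Adm.section_measurable hv ω
    have s1 := isSol_sol hf ht0T m1 m2 x
    have s2 := isSol_sol hf hkT m1 m2 (y j.unpair.1)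
    have s3 := s1.restart hf ht0 ⟨h0, hkT.2⟩ m1 m2
    have hdist := s2.norm_sub_le hf hkT.1 le_rfl s3 m1 m2 m1 m2 (ae_of_all _ fun _ _ => rfl)
      (ae_of_all _ fun _ _ => rfl) T ⟨hkT.2, le_rfl⟩
    have hMω : M v ω = j.unpair.1 := by
      have hNω : N v ω = j := hω
      rw [← hNω]
      simp [N]
    have hclose : ‖y j.unpair.1 - X v ω‖ < ε' := by
      rw [← hMω]
      exact Nat.find_spec (hyd (X v ω))
    rw [a2] at hclose
    have hlip := (abs_le.1 (hg.lip (sol f T (π.t k) (y j.unpair.1) (fun r => u r ω)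
      (fun r => v r ω) T) (sol f T t0 x (fun r => u r ω) (fun r => v r ω) T))).2
    have hle : L * ‖sol f T (π.t k) (y j.unpair.1) (fun r => u r ω) (fun r => v r ω) T
        - sol f T t0 x (fun r => u r ω) (fun r => v r ω) T‖
        ≤ L * (2 * ε' * Real.exp (2 * K * T)) := by
      refine mul_le_mul_of_nonneg_left (hdist.trans ?_) hg.nonneg
      gcongr
      exact hclose.le
    have hgoal := hlip.trans hle
    change _ ≤ g (sol f T t0 x (fun r => u r ω) (fun r => v r ω) T) + _
    linarith
  have hopt' : ∀ j : ℕ, ∀ᵐ ω ∂P, N v ω = j →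
      lowerValD U V f g P π (π.t k) (y j.unpair.1) - ε
        ≤ (P[payoff f g P π (π.t k) (y j.unpair.1) (a j.unpair.1 j.unpair.2)
        (fun w => β fun s ω => if s < π.t k then u s ω else w s ω) | Fsig k]) ω := by
    intro j
    filter_upwards [hopt j.unpair.1 j.unpair.2 _ hβ'] with ω hω hNω
    refine hω ?_
    rw [← hNω]
    simp [N]
  filter_upwards [ae_all_iff.2 hj, ae_all_iff.2 hopt', hX] with ω a1 a2 a3
  refine ⟨y (M v ω), ?_, ?_⟩
  · rw [← a3]
    exact Nat.find_spec (hyd (X v ω))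
  · have b1 := a1 (N v ω) rfl
    have b2 := a2 (N v ω) rfl
    have hM : (N v ω).unpair.1 = M v ω := by simp [N]
    rw [hM] at b2 b1
    linarith

end Concatenation

/-! ### Averaging over the fresh randomisation of the first player -/

section Averaging

variable {P : Measure Omega} [IsProbabilityMeasure P] {T : ℝ} {π : Partition T}
  {U V : Type*} [MeasurableSpace U] [MeasurableSpace V] [MeasurableSingletonClass V]
  {q : U × V → ℝ} {D c : ℝ} {ψ : I → U} {v : ℝ → Omega → V}

theorem measurable_randomControl (hψ : Measurable ψ) :
    Measurable (Function.uncurry (randomControl π ψ)) :=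
  (randomControl_mem_Adm (π := π) hψ).1

theorem mul_measureReal_le_setIntegral (hP : IsProductMeasure P) (hq : Measurable q)
    (hD : ∀ z, |q z| ≤ D) (hψ : Measurable ψ) (hc : ∀ b, c ≤ ∫ r, q (ψ r, b))
    (hv : v ∈ Adm Hsig V π) {i : ℕ} {s : ℝ} (hs : s ∈ Ico 0 T) (hi : i ≤ π.idx s) {A : Set Omega}
    (hA : MeasurableSet[Fsig i] A) :
    c * P.real A ≤ ∫ ω in A, q (randomControl π ψ s ω, v s ω) ∂P := by
  set j := π.idx s with hj
  have hjn : j < π.n := π.idx_lt s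
  have hsj : s ∈ Ico (π.t j) (π.t (j + 1)) := ⟨π.t_idx_le hs.1, π.lt_t_idx_succ hs.2⟩
  have hAm : MeasurableSet A := Fsig_le i A hA
  have hmp := measurePreserving_update hP j
  set F : Omega → ℝ := fun ω => q (randomControl π ψ s ω, v s ω) with hF
  have hFm : Measurable F := hq.comp
    (((measurable_randomControl hψ).comp (measurable_const.prodMk measurable_id)).prodMk
      (hv.1.comp (measurable_const.prodMk measurable_id)))
  have hind : Measurable (A.indicator F) := hFm.indicator hAm
  have hbd : ∀ ω, ‖A.indicator F ω‖ ≤ D := fun ω =>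
    (norm_indicator_le_norm_self F ω).trans (hD _)
  have hI : Integrable (fun p : Omega × (I × I) => A.indicator F (Function.update p.1 j p.2))
      (P.prod volume) :=
    Integrable.of_bound (C := D) (hind.comp hmp.measurable).aestronglyMeasurable
      (ae_of_all _ fun p => hbd _)
  have key : ∀ ω, A.indicator (fun _ => c) ω
      ≤ ∫ ζ : I × I, A.indicator F (Function.update ω j ζ) := by
    intro ω
    have hmem : ∀ ζ, Function.update ω j ζ ∈ A ↔ ω ∈ A := fun ζ =>
      mem_iff_of_measurableSet_Fsig hA fun l hl =>
        Function.update_of_ne (hl.trans_le hi).ne _ _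
    by_cases hω : ω ∈ A
    swap
    · have : ∀ ζ, A.indicator F (Function.update ω j ζ) = 0 := fun ζ =>
        indicator_of_notMem (fun h => hω ((hmem ζ).1 h)) _
      simp [this, hω]
    have heq : ∀ ζ : I × I, A.indicator F (Function.update ω j ζ)
        = q (ψ ζ.1, v s (Function.update ω j (0, ζ.2))) := by
      intro ζ
      rw [indicator_of_mem ((hmem ζ).2 hω)]
      have h1 : randomControl π ψ s (Function.update ω j ζ) = ψ ζ.1 := by
        simp [randomControl, ← hj]
      have h2 : v s (Function.update ω j ζ) = v s (Function.update ω j (0, ζ.2)) :=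
        Adm2.eq_of_agree hv hjn hsj (fun l hl => by
          rw [Function.update_of_ne hl.ne, Function.update_of_ne hl.ne]) (by simp)
      simp only [hF, h1, h2]
    have hvm : Measurable fun b : I => v s (Function.update ω j (0, b)) :=
      hv.1.comp (measurable_const.prodMk
        ((measurable_update ω).comp (measurable_const.prodMk measurable_id)))
    have hIω : Integrable (fun ζ : I × I => q (ψ ζ.1, v s (Function.update ω j (0, ζ.2))))
        ((volume : Measure I).prod volume) :=
      Integrable.of_bound (C := D) (hq.comp ((hψ.comp measurable_fst).prodMk
        (hvm.comp measurable_snd))).aestronglyMeasurable (ae_of_all _ fun p => hD _)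
    simp only [heq, indicator_of_mem hω]
    calc c = ∫ _ : I, c := by simp
      _ ≤ ∫ b : I, ∫ r : I, q (ψ r, v s (Function.update ω j (0, b))) :=
          integral_mono (integrable_const _) hIω.integral_prod_right fun b => hc _
      _ = _ := (integral_prod_symm _ hIω).symm
  calc c * P.real A = ∫ ω, A.indicator (fun _ => c) ω ∂P := by
        rw [integral_indicator hAm]; simp [mul_comm]
    _ ≤ ∫ ω, (∫ ζ : I × I, A.indicator F (Function.update ω j ζ)) ∂P :=
        integral_mono ((integrable_const c).indicator hAm) hI.integral_prod_left key
    _ = ∫ p, A.indicator F (Function.update p.1 j p.2) ∂(P.prod volume) :=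
        (integral_prod _ hI).symm
    _ = ∫ ω, A.indicator F ω ∂P := by
        conv_rhs => rw [← hmp.map_eq]
        exact (integral_map hmp.measurable.aemeasurable hind.aestronglyMeasurable).symm
    _ = _ := integral_indicator hAm

/-- The running reward along the fresh randomisation of the first player is bounded below in
conditional mean. -/
theorem le_condExp_integral_randomControl (hP : IsProductMeasure P) (hq : Measurable q)
    (hD : ∀ z, |q z| ≤ D) (hψ : Measurable ψ) (hc : ∀ b, c ≤ ∫ r, q (ψ r, b))
    (hv : v ∈ Adm Hsig V π) {t0 t1 : ℝ} (ht0 : 0 ≤ t0) (h01 : t0 ≤ t1) (ht1 : t1 ≤ T) :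
    ∀ᵐ ω ∂P, c * (t1 - t0) ≤
      (P[fun ω => ∫ s in t0..t1, q (randomControl π ψ s ω, v s ω) | Fsig (π.idx t0)]) ω := by
  set i := π.idx t0
  have hqm : Measurable fun p : ℝ × Omega => q (randomControl π ψ p.1 p.2, v p.1 p.2) :=
    hq.comp ((measurable_randomControl hψ).prodMk hv.1)
  have hint : ∀ A : Set Omega, Integrable
      (Function.uncurry fun s ω => q (randomControl π ψ s ω, v s ω))
      ((volume.restrict (uIoc t0 t1)).prod (P.restrict A)) := by
    intro A
    have : IsFiniteMeasure (volume.restrict (uIoc t0 t1)) := by rw [uIoc]; infer_instance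
    exact Integrable.of_bound (C := D) hqm.aestronglyMeasurable (ae_of_all _ fun p => hD _)
  set ξ : Omega → ℝ := fun ω => ∫ s in t0..t1, q (randomControl π ψ s ω, v s ω) with hξ
  have hξi : Integrable ξ P := by
    have := (hint univ).integral_prod_right
    rw [Measure.restrict_univ, uIoc_of_le h01] at this
    simpa only [hξ, intervalIntegral.integral_of_le h01, Function.uncurry] using this
  refine ae_le_of_ae_le_trim (hm := Fsig_le i) (f₁ := fun _ => c * (t1 - t0)) ?_
  refine ae_le_of_forall_setIntegral_le (integrable_const _)
    (integrable_condExp.trim (Fsig_le i) stronglyMeasurable_condExp) fun A hA _ => ?_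
  rw [← setIntegral_trim (Fsig_le i) stronglyMeasurable_condExp hA,
    ← setIntegral_trim (Fsig_le i) stronglyMeasurable_const hA, setIntegral_condExp (Fsig_le i) hξi hA,
    hξ, ← intervalIntegral_integral_swap (hint A)]
  calc ∫ _ in A, c * (t1 - t0) ∂P = ∫ _ in t0..t1, c * P.real A := by
        simp; ring
    _ ≤ _ := by
        refine intervalIntegral.integral_mono_on_of_le_Ioo h01 intervalIntegrable_const ?_ ?_
        · rw [intervalIntegrable_iff]
          exact (hint A).integral_prod_left
        · intro s hs
          have hs0 : s ∈ Ico 0 T := ⟨ht0.trans hs.1.le, hs.2.trans_le ht1⟩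
          exact mul_measureReal_le_setIntegral hP hq hD hψ hc hv hs0
            (π.le_idx (π.idx_lt t0) ((π.t_idx_le ht0).trans hs.1.le)) hA

end Averaging

/-! ### Values dominate the gain of one randomised step -/

section OneStep

variable {P : Measure Omega} [IsProbabilityMeasure P] {T : ℝ} {π : Partition T}
  {d : ℕ} {U V : Type} [MetricSpace U] [CompactSpace U] [MetricSpace V] [CompactSpace V]
  [MeasurableSpace U] [BorelSpace U] [MeasurableSpace V] [BorelSpace V] [Nonempty U] [Nonempty V]
  {f : ℝ → EuclideanSpace ℝ (Fin d) → U → V → EuclideanSpace ℝ (Fin d)}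
  {g : EuclideanSpace ℝ (Fin d) → ℝ} {C K B L : ℝ}

theorem IsRegular.continuous_control (hf : IsRegular T f C K) {t : ℝ} (ht : t ∈ Icc 0 T)
    (x : EuclideanSpace ℝ (Fin d)) : Continuous fun z : U × V => f t x z.1 z.2 :=
  hf.cont.comp_continuous (f := fun z : U × V => (t, x, z)) (by fun_prop)
    fun _ => ⟨ht, mem_univ _⟩

theorem abs_inner_le (hf : IsRegular T f C K) (t : ℝ) (x p : EuclideanSpace ℝ (Fin d)) (a : U)
    (b : V) : |⟪f t x a b, p⟫| ≤ C * ‖p‖ :=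
  (abs_real_inner_le_norm _ _).trans
    (mul_le_mul_of_nonneg_right (hf.bdd _ _ _ _) (norm_nonneg _))

/-- The displacement of a trajectory in a direction `p` is at least the integral of the reward
frozen at the starting point, up to the oscillation of the dynamics. -/
theorem IsSol.integral_sub_le_inner (hf : IsRegular T f C K) {t0 t1 δ : ℝ} (ht0 : 0 ≤ t0)
    (h01 : t0 ≤ t1) (ht1 : t1 ≤ T) {x p : EuclideanSpace ℝ (Fin d)} {u : ℝ → U} {v : ℝ → V}
    (hu : Measurable u) (hv : Measurable v) {X : ℝ → EuclideanSpace ℝ (Fin d)}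
    (hX : IsSol f T t0 x u v X)
    (hδ : ∀ s ∈ Icc t0 t1, ∀ y, ‖y - x‖ ≤ C * (t1 - t0) → ∀ a b,
      ⟪f t0 x a b, p⟫ - δ ≤ ⟪f s y a b, p⟫) :
    (∫ s in t0..t1, ⟪f t0 x (u s) (v s), p⟫) - δ * (t1 - t0) ≤ ⟪X t1 - x, p⟫ := by
  have hT : 0 ≤ T := ht0.trans (h01.trans ht1)
  have hfX : IntervalIntegrable (fun r => f r (X r) (u r) (v r)) volume t0 t1 := by
    refine (hf.intervalIntegrable_frozen hT (hX.1.mono ?_) hu hv).congr fun r hr => ?_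
    · rw [uIcc_of_le h01]; exact Icc_subset_Icc_right ht1
    · rw [uIoc_of_le h01] at hr
      exact congrFun (congrFun (congrFun (frozen_of_mem hT
        ⟨ht0.trans hr.1.le, hr.2.trans ht1⟩) _) _) _
  have hIq : IntervalIntegrable (fun s => ⟪f t0 x (u s) (v s), p⟫) volume t0 t1 := by
    rw [intervalIntegrable_iff, uIoc_of_le h01]
    refine Integrable.of_bound (C := C * ‖p‖) ?_ (ae_of_all _ fun s => abs_inner_le hf _ _ _ _ _)
    exact (((hf.continuous_control ⟨ht0, h01.trans ht1⟩ x).measurable.comp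
      (hu.prodMk hv)).inner measurable_const).aestronglyMeasurable
  have hcomm : ⟪X t1 - x, p⟫ = ∫ s in t0..t1, ⟪f s (X s) (u s) (v s), p⟫ := by
    rw [hX.2 t1 ⟨h01, ht1⟩, add_sub_cancel_left, real_inner_comm]
    have h := ((innerSL ℝ p).intervalIntegral_comp_comm hfX).symm
    simp only [innerSL_apply_apply] at h
    rw [h]
    simp only [real_inner_comm]
  have hsub : (∫ s in t0..t1, ⟪f t0 x (u s) (v s), p⟫) - δ * (t1 - t0)
      = ∫ s in t0..t1, (⟪f t0 x (u s) (v s), p⟫ - δ) := by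
    rw [intervalIntegral.integral_sub hIq intervalIntegrable_const]
    simp [mul_comm]
  rw [hcomm, hsub]
  refine intervalIntegral.integral_mono_on h01 (hIq.sub intervalIntegrable_const) ?_ fun s hs => ?_
  · have h : IntervalIntegrable (fun r => innerSL ℝ p (f r (X r) (u r) (v r))) volume t0 t1 :=
      ⟨(innerSL ℝ p).integrable_comp hfX.1, (innerSL ℝ p).integrable_comp hfX.2⟩
    simpa only [innerSL_apply_apply, real_inner_comm] using h
  · refine hδ s hs _ ?_ _ _
    refine (hX.norm_sub_initial_le hf ⟨hs.1, hs.2.trans ht1⟩).trans ?_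
    have := hf.nonneg
    gcongr
    exact hs.2

theorem le_lowerValD_of_randomControl (hP : IsProductMeasure P) (hf : IsRegular T f C K)
    (hg : IsRegularPayoff g B L) {t0 : ℝ} (ht0 : 0 ≤ t0) {k : ℕ} (hk : k < π.n)
    (h0 : t0 ≤ π.t k) (x p : EuclideanSpace ℝ (Fin d)) {ψ : I → U} (hψ : Measurable ψ) {c : ℝ}
    (hc : ∀ b, c ≤ ∫ r, ⟪f t0 x (ψ r) b, p⟫) {δ : ℝ}
    (hδ : ∀ s ∈ Icc t0 (π.t k), ∀ y, ‖y - x‖ ≤ C * (π.t k - t0) → ∀ a b,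
      ⟪f t0 x a b, p⟫ - δ ≤ ⟪f s y a b, p⟫)
    {η m : ℝ} (hη : 0 < η) (hm : ∀ y, ‖y - x‖ ≤ C * (π.t k - t0) + η →
      m + ⟪y - x, p⟫ ≤ lowerValD U V f g P π (π.t k) y) :
    m + (c - δ) * (π.t k - t0) - η * (1 + ‖p‖ + 2 * L * Real.exp (2 * K * T))
      ≤ lowerValD U V f g P π t0 x := by
  have hkT := (π.t_mem hk.le).2
  have ht0T : t0 ∈ Icc 0 T := ⟨ht0, h0.trans hkT⟩
  obtain ⟨α, hα, hα0, hopt⟩ := exists_strategy_concat (U := U) (V := V) hP hf hg ht0 hk h0 x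
    (randomControl_mem_Adm (π := π) hψ) hη hη
  refine le_lowerValD hg hα fun β hβ => ?_
  obtain ⟨hu, hv, h1, -⟩ := isFixPair_fixPair ht0 hα hβ
  set u := (fixPair P π t0 T α β).1 with hu_def
  set v := (fixPair P π t0 T α β).2 with hv_def
  set q : U × V → ℝ := fun z => ⟪f t0 x z.1 z.2, p⟫ with hq
  have hqm : Measurable q :=
    (hf.continuous_control ht0T x).measurable.inner measurable_const
  have hqD : ∀ z, |q z| ≤ C * ‖p‖ := fun z => abs_inner_le hf _ _ _ _ _
  set ξ : Omega → ℝ := fun ω => ∫ s in t0..π.t k, q (randomControl π ψ s ω, v s ω) with hξ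
  have hcond := le_condExp_integral_randomControl hP hqm hqD hψ hc hv ht0 h0 hkT
  set m' := m - δ * (π.t k - t0) - η * (1 + ‖p‖ + 2 * L * Real.exp (2 * K * T)) with hm'
  have hpt : ∀ᵐ ω ∂P, m' + ξ ω ≤ (P[payoff f g P π t0 x α β | Fsig k]) ω := by
    filter_upwards [hopt β hβ,
      ae_ae_swap (p := fun s ω => s ∈ Icc t0 T → α v s ω = u s ω) h1] with ω ⟨y, hy, hle⟩ hω
    have mu := Adm.section_measurable hu ω
    have mv := Adm.section_measurable hv ω
    have hsol := isSol_sol hf ht0T mu mv x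
    set X := sol f T t0 x (fun r => u r ω) (fun r => v r ω) with hX
    have hXy : ‖y - X (π.t k)‖ < η := hy
    have hb1 : ‖X (π.t k) - x‖ ≤ C * (π.t k - t0) := hsol.norm_sub_initial_le hf ⟨h0, hkT⟩
    have hb2 := hsol.integral_sub_le_inner hf ht0 h0 hkT mu mv hδ
    have hb3 : ξ ω = ∫ s in t0..π.t k, ⟪f t0 x (u s ω) (v s ω), p⟫ := by
      simp only [hξ, intervalIntegral.integral_of_le h0]
      refine integral_congr_ae ?_
      rw [Filter.EventuallyEq, ae_restrict_iff' measurableSet_Ioc]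
      filter_upwards [hω, Measure.ae_ne volume (π.t k)] with s hs hne hs'
      rw [← hs ⟨hs'.1.le, hs'.2.trans hkT⟩, hα0 _ _ (lt_of_le_of_ne hs'.2 hne)]
    have hb4 : ‖y - x‖ ≤ C * (π.t k - t0) + η := by
      have := norm_add_le (y - X (π.t k)) (X (π.t k) - x)
      rw [sub_add_sub_cancel] at this
      linarith
    have hb5 : ⟪y - x, p⟫ = ⟪y - X (π.t k), p⟫ + ⟪X (π.t k) - x, p⟫ := by
      rw [← inner_add_left, sub_add_sub_cancel]
    have hb6 : -(η * ‖p‖) ≤ ⟪y - X (π.t k), p⟫ :=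
      (abs_le.1 ((abs_real_inner_le_norm _ _).trans
        (mul_le_mul_of_nonneg_right hXy.le (norm_nonneg p)))).1
    have hb7 := hm y hb4
    rw [hb3, hm']
    linarith
  have hik : π.idx t0 ≤ k := by
    rw [← π.idx_t hk]
    exact π.le_idx (π.idx_lt _) ((π.t_idx_le ht0).trans h0)
  have hξi : Integrable ξ P := by
    have hI : Integrable (Function.uncurry fun s ω => q (randomControl π ψ s ω, v s ω))
        ((volume.restrict (Ioc t0 (π.t k))).prod P) :=
      Integrable.of_bound (C := C * ‖p‖) (hqm.comp
        ((measurable_randomControl hψ).prodMk hv.1)).aestronglyMeasurable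
        (ae_of_all _ fun p => hqD _)
    simpa only [hξ, intervalIntegral.integral_of_le h0, Function.uncurry] using
      hI.integral_prod_right
  have hmono := condExp_mono (m := Fsig (π.idx t0)) ((integrable_const m').add hξi)
    integrable_condExp hpt
  filter_upwards [hmono, hcond, condExp_add (integrable_const m') hξi (Fsig (π.idx t0)),
    condExp_condExp_of_le (f := payoff f g P π t0 x α β) (μ := P) (Fsig_mono hik) (Fsig_le k)]
    with ω a1 a2 a3 a4
  rw [a4, a3, Pi.add_apply, condExp_const (Fsig_le _)] at a1
  have : m + (c - δ) * (π.t k - t0) - η * (1 + ‖p‖ + 2 * L * Real.exp (2 * K * T))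
      = m' + c * (π.t k - t0) := by rw [hm']; ring
  rw [this]
  exact (add_le_add_right a2 m').trans a1

end OneStep

/-! ### The viscosity supersolution property of limits -/

section Limit

variable {P : Measure Omega} [IsProbabilityMeasure P] {T : ℝ}
  {d : ℕ} {U V : Type} [MetricSpace U] [CompactSpace U] [MetricSpace V] [CompactSpace V]
  [MeasurableSpace U] [BorelSpace U] [MeasurableSpace V] [BorelSpace V] [Nonempty U] [Nonempty V]
  {f : ℝ → EuclideanSpace ℝ (Fin d) → U → V → EuclideanSpace ℝ (Fin d)}
  {g : EuclideanSpace ℝ (Fin d) → ℝ} {C K B L : ℝ}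

theorem Partition.exists_t_mem_Icc (π : Partition T) {t h : ℝ} (ht : 0 ≤ t) (hh : 0 ≤ h)
    (hT : t + h < T) (hmesh : π.mesh ≤ h / 2) : ∃ k < π.n, π.t k ∈ Icc (t + h / 2) (t + h) := by
  have h1 := π.lt_t_idx_succ hT
  have h2 := π.sub_le_mesh (π.idx_lt (t + h))
  exact ⟨_, π.idx_lt (t + h), by linarith, π.t_idx_le (by linarith)⟩

theorem lowerValD_terminal (hf : IsRegular T f C K) (hg : IsRegularPayoff g B L) (hT : 0 ≤ T)
    (π : Partition T) (x : EuclideanSpace ℝ (Fin d)) :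
    lowerValD U V f g P π T x = g x := by
  have hpay : ∀ (α : (ℝ → Omega → V) → (ℝ → Omega → U)) (β : (ℝ → Omega → U) → (ℝ → Omega → V)),
      IsNAD1 U V P π T α → IsNAD2 U V P π T β →
        P[payoff f g P π T x α β | Fsig (π.idx T)] = fun _ => g x := by
    intro α β hα hβ
    obtain ⟨hu, hv, -, -⟩ := isFixPair_fixPair hT hα hβ
    have : payoff f g P π T x α β = fun _ => g x := by
      funext ω
      have h := (isSol_sol hf ⟨hT, le_rfl⟩ (Adm.section_measurable hu ω)
        (Adm.section_measurable hv ω) x).2 T ⟨le_rfl, le_rfl⟩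
      rw [intervalIntegral.integral_same, add_zero] at h
      exact congrArg g h
    rw [this]
    exact condExp_const (Fsig_le _) _
  have hu : IsNAD1 U V P π T fun _ _ _ => Classical.arbitrary U :=
    isNAD_const (const_mem_Adm _)
  have hv : IsNAD2 U V P π T fun _ _ _ => Classical.arbitrary V :=
    isNAD_const (const_mem_Adm _)
  refine le_antisymm (lowerValD_le hg fun α hα => ⟨_, hv, ?_⟩)
    (le_lowerValD hg hu fun β hβ => ?_)
  · rw [hpay _ _ hα hv]; exact ae_of_all _ fun _ => le_rfl
  · rw [hpay _ _ hu hβ]; exact ae_of_all _ fun _ => le_rfl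

/-- Every level below the Hamiltonian is guaranteed by a mixed action, realised through a
uniformly distributed variable. -/
theorem exists_randomization_of_lt_ham (hf : IsRegular T f C K) {t : ℝ} (ht : t ∈ Icc 0 T)
    {x p : EuclideanSpace ℝ (Fin d)} {c : ℝ} (hc : c < ham U V f t x p) :
    ∃ ψ : I → U, Measurable ψ ∧ ∀ b, c ≤ ∫ r, ⟪f t x (ψ r) b, p⟫ := by
  have : Nonempty (ProbabilityMeasure U) :=
    ⟨⟨Measure.dirac (Classical.arbitrary U), inferInstance⟩⟩
  obtain ⟨μ, hμ⟩ := exists_lt_of_lt_ciSup hc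
  obtain ⟨ψ, hψ, hmap⟩ := (μ : Measure U).exists_measurable_map_eq
  have hbdd : BddBelow (range fun ν : ProbabilityMeasure V => ⟪ftilde U V f t x μ ν, p⟫) := by
    refine ⟨-(C * ‖p‖), ?_⟩
    rintro _ ⟨ν, rfl⟩
    refine (abs_le.1 ((abs_real_inner_le_norm _ _).trans
      (mul_le_mul_of_nonneg_right ?_ (norm_nonneg p)))).1
    have h1 : ∀ a, ‖∫ b, f t x a b ∂(ν : Measure V)‖ ≤ C := fun a => by
      simpa using norm_integral_le_of_norm_le_const (μ := (ν : Measure V))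
        (ae_of_all _ fun b => hf.bdd t x a b)
    simpa [ftilde] using norm_integral_le_of_norm_le_const (μ := (μ : Measure U)) (ae_of_all _ h1)
  refine ⟨ψ, hψ, fun b => ?_⟩
  have h := hμ.le.trans (ciInf_le hbdd ⟨Measure.dirac b, inferInstance⟩)
  have hm : Measurable fun a => f t x a b :=
    ((hf.continuous_control ht x).comp (by fun_prop : Continuous fun a : U => (a, b))).measurable
  have hint : Integrable (fun a => f t x a b) (μ : Measure U) :=
    Integrable.of_bound (C := C) hm.aestronglyMeasurable (ae_of_all _ fun a => hf.bdd _ _ _ _)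
  have heq : ⟪ftilde U V f t x μ ⟨Measure.dirac b, inferInstance⟩, p⟫
      = ∫ r, ⟪f t x (ψ r) b, p⟫ := by
    simp only [ftilde, ProbabilityMeasure.coe_mk, integral_dirac]
    rw [real_inner_comm, ← integral_inner hint p, ← hmap, integral_map hψ.aemeasurable
      (measurable_const.inner hm).aestronglyMeasurable]
    simp only [real_inner_comm]
  rwa [heq] at h

/-- The dynamics is continuous in time and space, uniformly in the controls. -/
theorem IsRegular.exists_inner_sub_le (hf : IsRegular T f C K) {t : ℝ} (ht : t ∈ Icc 0 T)
    (x p : EuclideanSpace ℝ (Fin d)) {δ : ℝ} (hδ : 0 < δ) :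
    ∃ r > 0, ∀ s ∈ Icc 0 T, |s - t| < r → ∀ y, ‖y - x‖ < r → ∀ a b,
      ⟪f t x a b, p⟫ - δ ≤ ⟪f s y a b, p⟫ := by
  have hcomp : IsCompact (Icc (0 : ℝ) T ×ˢ (Metric.closedBall x 1 ×ˢ
      (univ : Set (U × V)))) := isCompact_Icc.prod ((isCompact_closedBall x 1).prod isCompact_univ)
  have hunif := hcomp.uniformContinuousOn_of_continuous
    (hf.cont.mono (prod_mono_right (subset_univ _)))
  have hδ' : 0 < δ / (‖p‖ + 1) := by positivity
  obtain ⟨r, hr, hd⟩ := Metric.uniformContinuousOn_iff.1 hunif _ hδ'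
  refine ⟨min r 1, by positivity, fun s hs hst y hy a b => ?_⟩
  have hyx : dist y x < min r 1 := by rwa [dist_eq_norm]
  have h := hd (s, y, a, b) ⟨hs, (hyx.le.trans (min_le_right _ _)), mem_univ _⟩
    (t, x, a, b) ⟨ht, Metric.mem_closedBall_self zero_le_one, mem_univ _⟩ (by
      simp only [Prod.dist_eq, dist_self, max_lt_iff]
      exact ⟨hst.trans_le (min_le_left _ _), hyx.trans_le (min_le_left _ _), hr⟩)
  rw [dist_eq_norm] at h
  have h2 : |⟪f s y a b - f t x a b, p⟫| ≤ δ := by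
    refine (abs_real_inner_le_norm _ _).trans ?_
    calc ‖f s y a b - f t x a b‖ * ‖p‖ ≤ δ / (‖p‖ + 1) * (‖p‖ + 1) := by
          gcongr
          linarith
      _ = δ := by field_simp
  rw [inner_sub_left] at h2
  linarith [(abs_le.1 h2).1]

/-- First-order lower expansion of a differentiable function of time and space. -/
theorem exists_expansion {φ : ℝ → EuclideanSpace ℝ (Fin d) → ℝ}
    {t : ℝ} {x : EuclideanSpace ℝ (Fin d)}
    (hφ : DifferentiableAt ℝ (fun q : ℝ × EuclideanSpace ℝ (Fin d) => φ q.1 q.2) (t, x))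
    {δ : ℝ} (hδ : 0 < δ) :
    ∀ᶠ q in 𝓝 (t, x), φ t x + deriv (fun s => φ s x) t * (q.1 - t)
      + ⟪q.2 - x, gradient (fun y => φ t y) x⟫ - δ * (|q.1 - t| + ‖q.2 - x‖) ≤ φ q.1 q.2 := by
  set D := fderiv ℝ (fun q : ℝ × EuclideanSpace ℝ (Fin d) => φ q.1 q.2) (t, x) with hD
  have hd := hφ.hasFDerivAt
  have h1 : deriv (fun s => φ s x) t = D (1, 0) := by
    have hc : HasDerivAt (fun s : ℝ => (s, x)) ((1 : ℝ), (0 : EuclideanSpace ℝ (Fin d))) t :=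
      (hasDerivAt_id t).prodMk (hasDerivAt_const t x)
    exact (hd.comp_hasDerivAt t hc).deriv
  have h2 : ∀ w, ⟪w, gradient (fun y => φ t y) x⟫ = D (0, w) := by
    intro w
    have hc : HasFDerivAt (fun y : EuclideanSpace ℝ (Fin d) => (t, y))
        (ContinuousLinearMap.inr ℝ ℝ (EuclideanSpace ℝ (Fin d))) x := hasFDerivAt_prodMk_right t x
    have h3 : fderiv ℝ (fun y => φ t y) x
        = D.comp (ContinuousLinearMap.inr ℝ ℝ (EuclideanSpace ℝ (Fin d))) :=
      (hd.comp x hc).fderiv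
    rw [gradient, h3, real_inner_comm, InnerProductSpace.toDual_symm_apply]
    simp
  have h4 := (hasFDerivAt_iff_isLittleO.1 hd).def hδ
  filter_upwards [h4] with q hq
  have h5 : D (q - (t, x)) = deriv (fun s => φ s x) t * (q.1 - t)
      + ⟪q.2 - x, gradient (fun y => φ t y) x⟫ := by
    rw [h1, h2]
    have : q - (t, x) = (q.1 - t) • ((1 : ℝ), (0 : EuclideanSpace ℝ (Fin d))) + (0, q.2 - x) := by
      ext <;> simp
    rw [this, map_add, map_smul, smul_eq_mul, mul_comm]
  have h6 : ‖q - (t, x)‖ ≤ |q.1 - t| + ‖q.2 - x‖ := by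
    rw [Prod.norm_def]
    exact max_le_add_of_nonneg (norm_nonneg _) (norm_nonneg _)
  have h7 := (abs_le.1 hq).1
  have h8 := mul_le_mul_of_nonneg_left h6 hδ.le
  rw [← hD, h5] at h7
  linarith

/-- The viscosity inequality at a local minimum of `W - φ`, for the limit `W` of the lower values
along partitions with vanishing mesh. -/
theorem deriv_add_ham_le_zero (hP : IsProductMeasure P) (hf : IsRegular T f C K)
    (hg : IsRegularPayoff g B L) {prt : ℕ → Partition T}
    (hmesh : Tendsto (fun n => (prt n).mesh) atTop (𝓝 0))
    {W : ℝ → EuclideanSpace ℝ (Fin d) → ℝ} {t : ℝ} (ht : t ∈ Ico 0 T)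
    {x : EuclideanSpace ℝ (Fin d)}
    (hconv : TendstoUniformlyOn (fun n q => lowerValD U V f g P (prt n) q.1 q.2)
      (fun q : ℝ × EuclideanSpace ℝ (Fin d) => W q.1 q.2) atTop
      (Icc 0 T ×ˢ Metric.closedBall x 1))
    {φ : ℝ → EuclideanSpace ℝ (Fin d) → ℝ}
    (hφ : DifferentiableAt ℝ (fun q : ℝ × EuclideanSpace ℝ (Fin d) => φ q.1 q.2) (t, x))
    (hmin : IsLocalMinOn (fun q : ℝ × EuclideanSpace ℝ (Fin d) => W q.1 q.2 - φ q.1 q.2)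
      (Icc (0 : ℝ) T ×ˢ univ) (t, x)) :
    deriv (fun s => φ s x) t + ham U V f t x (gradient (fun y => φ t y) x) ≤ 0 := by
  by_contra! hpos
  have htT : t ∈ Icc 0 T := ⟨ht.1, ht.2.le⟩
  set a := deriv (fun s => φ s x) t with ha
  set p := gradient (fun y => φ t y) x with hp
  set γ := a + ham U V f t x p with hγ
  have hC := hf.nonneg
  have hL := hg.nonneg
  obtain ⟨ψ, hψ, hc⟩ := exists_randomization_of_lt_ham (U := U) (V := V) hf htT (x := x) (p := p)
    (c := ham U V f t x p - γ / 4) (by linarith)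
  obtain ⟨r₁, hr₁, hosc⟩ := hf.exists_inner_sub_le htT x p (δ := γ / 4) (by linarith)
  set δ := γ / (8 * (1 + C)) with hδ
  have hδ0 : 0 < δ := by positivity
  have hδC : δ * (1 + C) = γ / 8 := by rw [hδ]; field_simp
  have hloc : ∀ᶠ q : ℝ × EuclideanSpace ℝ (Fin d) in 𝓝 (t, x), q ∈ Icc (0 : ℝ) T ×ˢ univ →
      W t x + a * (q.1 - t) + ⟪q.2 - x, p⟫ - δ * (|q.1 - t| + ‖q.2 - x‖) ≤ W q.1 q.2 := by
    filter_upwards [exists_expansion hφ hδ0, eventually_nhdsWithin_iff.1 hmin] with q h1 h2 hq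
    have := h2 hq
    linarith
  obtain ⟨r₂, hr₂, hball⟩ := Metric.eventually_nhds_iff.1 hloc
  set r := min (min r₁ r₂) 1 with hr
  have hr0 : 0 < r := by positivity
  have hrr₁ : r ≤ r₁ := (min_le_left _ _).trans (min_le_left _ _)
  have hrr₂ : r ≤ r₂ := (min_le_left _ _).trans (min_le_right _ _)
  have hr1 : r ≤ 1 := min_le_right _ _
  obtain ⟨h, hh0, hhT, hhr⟩ : ∃ h > 0, t + h < T ∧ (1 + C) * h ≤ r / 4 := by
    refine ⟨min ((T - t) / 2) (r / (4 * (1 + C))), lt_min (by linarith [ht.2]) (by positivity),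
      ?_, ?_⟩
    · linarith [min_le_left ((T - t) / 2) (r / (4 * (1 + C))), ht.2]
    · calc (1 + C) * min ((T - t) / 2) (r / (4 * (1 + C))) ≤ (1 + C) * (r / (4 * (1 + C))) :=
            mul_le_mul_of_nonneg_left (min_le_right _ _) (by linarith)
        _ = r / 4 := by field_simp
  set M := 1 + ‖p‖ + 2 * L * Real.exp (2 * K * T) with hM
  have hM0 : 0 ≤ M := by positivity
  obtain ⟨η, hη0, hηr, hηM⟩ : ∃ η > 0, η ≤ r / 4 ∧ η * (M + 2 + δ) ≤ γ * h / 16 := by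
    refine ⟨min (r / 4) (γ * h / (16 * (M + 2 + δ))), by positivity, min_le_left _ _, ?_⟩
    calc _ ≤ γ * h / (16 * (M + 2 + δ)) * (M + 2 + δ) :=
          mul_le_mul_of_nonneg_right (min_le_right _ _) (by positivity)
      _ = γ * h / 16 := by field_simp
  obtain ⟨n, hn1, hn2⟩ := ((hmesh.eventually_le_const (by linarith : 0 < h / 2)).and
    (Metric.tendstoUniformlyOn_iff.1 hconv η hη0)).exists
  obtain ⟨k, hk, hk1, hk2⟩ := (prt n).exists_t_mem_Icc ht.1 hh0.le hhT hn1
  set τ := (prt n).t k - t with hτ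
  have hτ0 : 0 ≤ τ := by linarith
  have hτh : τ ≤ h := by linarith
  have hh_le : h ≤ r / 4 := by nlinarith
  have hCτ : C * τ ≤ r / 4 := by nlinarith
  have hstep := le_lowerValD_of_randomControl (m := W t x + a * τ - δ * (τ + (C * τ + η)) - η) hP
    hf hg ht.1 hk (by linarith) x p hψ hc (δ := γ / 4) (fun s hs y hy b b' => by
      refine hosc s ⟨ht.1.trans hs.1, hs.2.trans ((prt n).t_mem hk.le).2⟩ ?_ y ?_ b b'
      · rw [abs_of_nonneg (by linarith [hs.1])]; linarith [hs.2]
      · linarith) hη0 (fun y hy => by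
      have hy1 : ‖y - x‖ ≤ r / 2 := by linarith
      have hkT := (prt n).t_mem hk.le
      have hq := hball (y := ((prt n).t k, y)) (by
        rw [Prod.dist_eq, max_lt_iff, Real.dist_eq, dist_eq_norm, abs_of_nonneg hτ0]
        constructor <;> linarith) ⟨hkT, mem_univ _⟩
      have hclose := hn2 ((prt n).t k, y) ⟨hkT, by
        rw [Metric.mem_closedBall, dist_eq_norm]; linarith⟩
      rw [Real.dist_eq] at hclose
      simp only [← hτ, abs_of_nonneg hτ0] at hq
      have hmul := mul_le_mul_of_nonneg_left hy hδ0.le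
      linarith [(abs_lt.1 hclose).2])
  have hlast := hn2 (t, x) ⟨htT, Metric.mem_closedBall_self zero_le_one⟩
  rw [Real.dist_eq] at hlast
  have hlast' := (abs_lt.1 hlast).1
  simp only at hlast'
  have hgain : γ * h / 16 < γ * τ * (3 / 8) := by nlinarith
  have hδτ : δ * (τ + C * τ) = γ / 8 * τ := by rw [← hδC]; ring
  have hfin : a * τ + (ham U V f t x p - γ / 4 - γ / 4) * τ = γ * τ / 2 := by rw [hγ]; ring
  linarith

end Limit

/-- **Statement 13 (Lemma 4.2).** If the lower value functions `V^{Π_n}` along a sequence of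
partitions with vanishing mesh converge uniformly on compacts to a function `V`, then `V` is a
viscosity supersolution of the Hamilton–Jacobi–Isaacs equation
`∂_t W + sup_{μ ∈ ΔU} inf_{ν ∈ ΔV} f̃(t,x,μ,ν)·∇W = 0`, `W(T,·) = g`. -/
theorem statement_14
    {d : ℕ} {U V : Type} [MetricSpace U] [CompactSpace U] [MetricSpace V] [CompactSpace V]
    [MeasurableSpace U] [BorelSpace U] [MeasurableSpace V] [BorelSpace V]
    [Nonempty U] [Nonempty V]
    (T : ℝ) (hT : 0 < T)
    (f : ℝ → EuclideanSpace ℝ (Fin d) → U → V → EuclideanSpace ℝ (Fin d))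
    (hf_bdd : ∃ C : ℝ, ∀ t x u v, ‖f t x u v‖ ≤ C)
    (hf_cont : ContinuousOn
      (fun q : ℝ × EuclideanSpace ℝ (Fin d) × U × V => f q.1 q.2.1 q.2.2.1 q.2.2.2)
      (Icc (0 : ℝ) T ×ˢ univ))
    (hf_lip : ∃ K : ℝ≥0, ∀ t u v, LipschitzWith K fun x => f t x u v)
    (g : EuclideanSpace ℝ (Fin d) → ℝ)
    (hg_bdd : ∃ C : ℝ, ∀ x, |g x| ≤ C)
    (hg_lip : ∃ K : ℝ≥0, LipschitzWith K g)
    (P : Measure Omega) [IsProbabilityMeasure P] (hP : IsProductMeasure P)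
    (prt : ℕ → Partition T)
    (hmesh : Tendsto (fun n => (prt n).mesh) atTop (𝓝 0))
    (W : ℝ → EuclideanSpace ℝ (Fin d) → ℝ)
    (hconv : ∀ K : Set (ℝ × EuclideanSpace ℝ (Fin d)),
      IsCompact K → K ⊆ Icc (0 : ℝ) T ×ˢ univ →
      TendstoUniformlyOn (fun n q => lowerValD U V f g P (prt n) q.1 q.2)
        (fun q => W q.1 q.2) atTop K) :
    IsViscSupersol U V f g T W := by
  obtain ⟨C, hC⟩ := hf_bdd
  obtain ⟨K, hK⟩ := hf_lip
  obtain ⟨B, hB⟩ := hg_bdd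
  obtain ⟨L, hL⟩ := hg_lip
  have hf : IsRegular T f C (K + 1) := by
    refine ⟨hC, hf_cont, by positivity, fun t u v x y => ?_⟩
    have h := (hK t u v).dist_le_mul x y
    rw [dist_eq_norm, dist_eq_norm] at h
    exact h.trans (mul_le_mul_of_nonneg_right (by simp) (norm_nonneg _))
  have hg : IsRegularPayoff g B L := by
    refine ⟨hB, L.2, fun x y => ?_⟩
    have h := hL.dist_le_mul x y
    rwa [Real.dist_eq, dist_eq_norm] at h
  refine ⟨fun x => ?_, fun φ hφ t x ht hmin => ?_⟩
  · have h := (hconv {(T, x)} isCompact_singleton (by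
      rintro _ rfl
      exact ⟨⟨hT.le, le_rfl⟩, mem_univ _⟩)).tendsto_at (mem_singleton _)
    simp only [lowerValD_terminal hf hg hT.le] at h
    exact (tendsto_nhds_unique tendsto_const_nhds h).le
  · exact deriv_add_ham_le_zero hP hf hg hmesh ht
      (hconv _ (isCompact_Icc.prod (isCompact_closedBall x 1)) (prod_mono_right (subset_univ _)))
      (hφ.differentiable one_ne_zero _) hmin

end DGameFormal
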